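/- Let F be a fixed finite family of graphs, each connected and with at least one edge, at least one of which is planar and subcubic. Let G be a connected graph with no excessive protrusions, no bouquets and no thetas. Then either G is F-free, or ‖G‖ ≤ c · OPT_F(G) for some constant c depending on F only. -/

import Mathlib

open Classical

attribute [local instance] Classical.propDecidable

noncomputable section

/-- A finite multigraph without loops: finitely many vertices, finitely many
edges (parallel edges are allowed since `E` is an abstract edge type),
each edge having two distinct endpoints. -/
structure Multigraph : Type 1 where
  V : Type
  E : Type
  fintypeV : Fintype V
  fintypeE : Fintype E
  ends : E → Sym2 V
  loopless : ∀ e : E, ¬ (ends e).IsDiag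

attribute [instance] Multigraph.fintypeV Multigraph.fintypeE

theorem sym2_map_not_isDiag {α β : Type} {f : α → β} (hf : Function.Injective f) :
    ∀ {p : Sym2 α}, ¬ p.IsDiag → ¬ (p.map f).IsDiag := by
  intro p
  induction p using Sym2.ind with
  | _ x y =>
    intro hp h
    rw [Sym2.map_pair_eq, Sym2.mk_isDiag_iff] at h
    exact hp (by rw [Sym2.mk_isDiag_iff]; exact hf h)

theorem sym2_isDiag_of_map {α β : Type} (f : α → β) (p : Sym2 α)
    (hinj : ∀ x ∈ p, ∀ y ∈ p, f x = f y → x = y)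
    (h : (p.map f).IsDiag) : p.IsDiag := by
  induction p using Sym2.ind with
  | _ a b =>
    rw [Sym2.map_pair_eq, Sym2.mk_isDiag_iff] at h
    rw [Sym2.mk_isDiag_iff]
    exact hinj a (Sym2.mem_mk_left a b) b (Sym2.mem_mk_right a b) h

namespace Multigraph

/-- `|G|`: the number of vertices of `G`. -/
def numVerts (G : Multigraph) : ℕ := Fintype.card G.V

/-- `‖G‖`: the number of edges of `G` (with multiplicities). -/
def numEdges (G : Multigraph) : ℕ := Fintype.card G.E

/-- The degree of a vertex: the number of incident edges. -/
def degree (G : Multigraph) (v : G.V) : ℕ := {e : G.E | v ∈ G.ends e}.ncard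

/-- A graph is subcubic if every vertex has degree at most `3`. -/
def Subcubic (G : Multigraph) : Prop := ∀ v : G.V, G.degree v ≤ 3

/-- The graph `G - D` obtained by deleting the set `D` of edges. -/
def deleteEdges (G : Multigraph) (D : Finset G.E) : Multigraph where
  V := G.V
  E := {e : G.E // e ∉ D}
  fintypeV := G.fintypeV
  fintypeE := Fintype.ofFinite _
  ends := fun e => G.ends e.1
  loopless := fun e => G.loopless e.1

/-- Walks in a multigraph, recorded as sequences of edges together with
compatible endpoints. -/
inductive Walk (G : Multigraph) : G.V → G.V → Type
  | nil (v : G.V) : Walk G v v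
  | cons {u v w : G.V} (e : G.E) (h : G.ends e = s(u, v)) (p : Walk G v w) : Walk G u w

/-- The list of edges traversed by a walk. -/
def Walk.edges {G : Multigraph} : {u v : G.V} → Walk G u v → List G.E
  | _, _, .nil _ => []
  | _, _, .cons e _ p => e :: p.edges

/-- The list of vertices visited by a walk. -/
def Walk.support {G : Multigraph} : {u v : G.V} → Walk G u v → List G.V
  | u, _, .nil _ => [u]
  | u, _, .cons _ _ p => u :: p.support

/-- A walk is a path if it has no repeated vertices. -/
def Walk.IsPath {G : Multigraph} {u v : G.V} (p : Walk G u v) : Prop := p.support.Nodup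

def Reachable (G : Multigraph) (u v : G.V) : Prop := Nonempty (Walk G u v)

/-- A multigraph is connected if it is nonempty and every two vertices are
joined by a walk. -/
def Connected (G : Multigraph) : Prop := Nonempty G.V ∧ ∀ u v : G.V, G.Reachable u v

/-- The vertex set of the connected component of `v`. -/
def component (G : Multigraph) (v : G.V) : Set G.V := {u | G.Reachable u v}

/-- Reachability inside a set `S` of vertices, i.e. reachability in `G[S]`. -/
def ReachIn (G : Multigraph) (S : Set G.V) (u v : G.V) : Prop :=
  ∃ p : Walk G u v, ∀ x ∈ p.support, x ∈ S

/-- The induced subgraph `G[S]` is connected. -/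
def ConnectedOn (G : Multigraph) (S : Set G.V) : Prop :=
  ∀ u ∈ S, ∀ v ∈ S, G.ReachIn S u v

/-- The number of connected components of the induced subgraph `G[S]`, expressed
as the maximum size of a family of vertices of `S` that are pairwise
non-connected within `S`. -/
def compCount (G : Multigraph) (S : Set G.V) : ℕ :=
  sSup {n | ∃ f : Fin n → G.V, (∀ i, f i ∈ S) ∧
    ∀ i j, i ≠ j → ¬ G.ReachIn S (f i) (f j)}

/-- The set of edges of the induced subgraph `G[X]`. -/
def inducedEdges (G : Multigraph) (X : Set G.V) : Set G.E :=
  {e | ∀ v ∈ G.ends e, v ∈ X}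

/-- The edge boundary `δ(X)`: edges with exactly one endpoint in `X`. -/
def edgeBoundary (G : Multigraph) (X : Set G.V) : Set G.E :=
  {e | ∃ u v : G.V, G.ends e = s(u, v) ∧ u ∈ X ∧ v ∉ X}

/-- The (open) neighbourhood `N(S)`. -/
def nbhd (G : Multigraph) (S : Set G.V) : Set G.V :=
  {u | u ∉ S ∧ ∃ (e : G.E) (v : G.V), v ∈ S ∧ G.ends e = s(u, v)}

/-- All parallel edges between `u` and `v`. -/
def parallelEdges (G : Multigraph) (u v : G.V) : Set G.E := {e | G.ends e = s(u, v)}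

/-- Planarity of a multigraph, via a topological embedding in the plane:
vertices map injectively to points, edges map to arcs between the images of
their endpoints, and two arcs may only meet at images of common endpoints. -/
def Planar (G : Multigraph) : Prop :=
  ∃ f : G.V → ℝ × ℝ, Function.Injective f ∧
    ∃ γ : G.E → ℝ → ℝ × ℝ,
      (∀ e, ContinuousOn (γ e) (Set.Icc 0 1)) ∧
      (∀ e, Set.InjOn (γ e) (Set.Icc 0 1)) ∧
      (∀ e, ∃ u v : G.V, G.ends e = s(u, v) ∧ γ e 0 = f u ∧ γ e 1 = f v) ∧
      (∀ (e : G.E) (v : G.V), f v ∈ γ e '' Set.Icc 0 1 → v ∈ G.ends e) ∧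
      (∀ e e' : G.E, e ≠ e' →
        ∀ pt ∈ γ e '' Set.Icc 0 1 ∩ γ e' '' Set.Icc 0 1, ∃ v : G.V, pt = f v)

/-- The disjoint union `G ⊎ H` of two multigraphs. -/
def disjUnion (G H : Multigraph) : Multigraph where
  V := G.V ⊕ H.V
  E := G.E ⊕ H.E
  fintypeV := Fintype.ofFinite _
  fintypeE := Fintype.ofFinite _
  ends := Sum.elim (fun e => (G.ends e).map Sum.inl) (fun e => (H.ends e).map Sum.inr)
  loopless := by
    rintro (e | e) h
    · exact sym2_map_not_isDiag Sum.inl_injective (G.loopless e) h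
    · exact sym2_map_not_isDiag Sum.inr_injective (H.loopless e) h

/-- The induced subgraph `G[S]` (equivalently, `G` with the vertices outside
`S` deleted). -/
def induce (G : Multigraph) (S : Set G.V) : Multigraph where
  V := ↥S
  E := {e : G.E // ∀ v ∈ G.ends e, v ∈ S}
  fintypeV := Fintype.ofFinite _
  fintypeE := Fintype.ofFinite _
  ends := fun e =>
    Sym2.map (fun a => if ha : a ∈ S then (⟨a, ha⟩ : ↥S)
      else ⟨(Quot.out (G.ends e.1)).1, e.2 _ (Sym2.out_fst_mem _)⟩) (G.ends e.1)
  loopless := by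
    intro e h
    apply G.loopless e.1
    refine sym2_isDiag_of_map _ _ (fun x hx' y hy' hf => ?_) h
    have hx : x ∈ S := e.2 x hx'
    have hy : y ∈ S := e.2 y hy'
    simp only [dif_pos hx, dif_pos hy] at hf
    exact congrArg Subtype.val hf

/-- Build a multigraph from a simple graph. -/
def ofSimple {V : Type} [Fintype V] (G : SimpleGraph V) : Multigraph where
  V := V
  E := G.edgeSet
  fintypeV := ‹Fintype V›
  fintypeE := Fintype.ofFinite _
  ends := Subtype.val
  loopless := fun e => SimpleGraph.not_isDiag_of_mem_edgeSet G e.2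

end Multigraph

open Multigraph

/-- An immersion of `H` into `G`: an injection on vertices together with
pairwise edge-disjoint paths in `G` joining the images of the endpoints of
the edges of `H`. -/
structure Immersion (H G : Multigraph) where
  vmap : H.V → G.V
  vmap_inj : Function.Injective vmap
  esrc : H.E → H.V
  etgt : H.E → H.V
  ends_eq : ∀ e : H.E, H.ends e = s(esrc e, etgt e)
  emap : (e : H.E) → Multigraph.Walk G (vmap (esrc e)) (vmap (etgt e))
  emap_path : ∀ e : H.E, (emap e).IsPath
  edge_disjoint : ∀ e e' : H.E, e ≠ e' → ∀ x : G.E, x ∈ (emap e).edges → x ∉ (emap e').edges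

/-- `G` contains `H` as an immersion. -/
def ContainsImm (G H : Multigraph) : Prop := Nonempty (Immersion H G)

/-- `G` is `F`-immersion-free. -/
def FFree {ι : Type} (F : ι → Multigraph) (G : Multigraph) : Prop :=
  ∀ i : ι, ¬ ContainsImm G (F i)

/-- The induced subgraph `G[X]` is `F`-immersion-free: there is no immersion
model of a member of `F` living entirely inside `X`. -/
def FFreeOn {ι : Type} (F : ι → Multigraph) (G : Multigraph) (X : Set G.V) : Prop :=
  ∀ i : ι, ¬ ∃ M : Immersion (F i) G, (∀ v, M.vmap v ∈ X) ∧
    ∀ (e : (F i).E), ∀ x ∈ (M.emap e).support, x ∈ X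

/-- `OPT_F(G)`: the minimum size of an edge set whose deletion makes `G`
`F`-immersion-free. -/
def OPT {ι : Type} (F : ι → Multigraph) (G : Multigraph) : ℕ :=
  sInf {k | ∃ D : Finset G.E, D.card = k ∧ FFree F (G.deleteEdges D)}

/-- `H` belongs to the immersion-obstruction set of the class `C`:
`H ∉ C` and every proper immersion of `H` belongs to `C`. -/
def InObsIm (C : Multigraph → Prop) (H : Multigraph) : Prop :=
  ¬ C H ∧ ∀ H' : Multigraph, ContainsImm H H' → ¬ ContainsImm H' H → C H'

/-- `MAX_F`: the maximum number of edges of a member of the family. -/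
def maxEdges {ι : Type} [Fintype ι] (F : ι → Multigraph) : ℕ :=
  Finset.univ.sup fun i => (F i).numEdges

/-- The underlying asymmetric adjacency relation of the `n × n` wall. -/
def wallRel (n : ℕ) (a b : Fin n × Fin (2 * n)) : Prop :=
  (a.1 = b.1 ∧ (a.2 : ℕ) + 1 = (b.2 : ℕ)) ∨
  (a.2 = b.2 ∧ (a.1 : ℕ) + 1 = (b.1 : ℕ) ∧ ((a.1 : ℕ) + (a.2 : ℕ)) % 2 = 0)

/-- The `n × n` wall graph `W_{n,n}`. -/
def Wall (n : ℕ) : Multigraph := Multigraph.ofSimple (SimpleGraph.fromRel (wallRel n))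

/-- A graph parameter is closed under immersions. -/
def ImmersionClosed (p : Multigraph → ℕ) : Prop :=
  ∀ G H : Multigraph, ContainsImm G H → p H ≤ p G

/-- A graph parameter is closed under disjoint unions. -/
def DisjUnionClosed (p : Multigraph → ℕ) : Prop :=
  ∀ G H : Multigraph, p (G.disjUnion H) = max (p G) (p H)

/-- A graph parameter is large on walls. -/
def LargeOnWalls (p : Multigraph → ℕ) : Prop :=
  (Set.range fun n : ℕ => p (Wall n)).Infinite

/-- The parameter `p_r`: the minimum number of edge deletions needed to bring
the value of `p` down to at most `r`. -/
def pAtMost (p : Multigraph → ℕ) (r : ℕ) (G : Multigraph) : ℕ :=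
  sInf {k | ∃ S : Finset G.E, S.card ≤ k ∧ p (G.deleteEdges S) ≤ r}

/-- A tree-cut decomposition of `G`: a forest `T` on node set `N` together with
a near-partition of `V(G)` into bags, such that the trees of the forest
correspond exactly to the connected components of `G`. -/
structure TreeCutDecomp (G : Multigraph) : Type 1 where
  N : Type
  fintypeN : Fintype N
  T : SimpleGraph N
  acyclic : T.IsAcyclic
  bag : N → Finset G.V
  nodeOf : G.V → N
  mem_bag : ∀ v : G.V, v ∈ bag (nodeOf v)
  bag_disjoint : ∀ t t' : N, t ≠ t' → Disjoint (bag t) (bag t')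
  comp_compat : ∀ u v : G.V, G.Reachable u v ↔ T.Reachable (nodeOf u) (nodeOf v)
  trees_used : ∀ t : N, ∃ v : G.V, T.Reachable t (nodeOf v)

attribute [instance] TreeCutDecomp.fintypeN

/-- A multigraph with a marked set of core vertices; the remaining vertices
are peripheral.  (Used for torsos and 3-centers.) -/
structure MarkedGraph : Type 1 where
  G : Multigraph
  core : Set G.V

/-- The vertex `z` has exactly two incident edges, one to `a` and one to `b`. -/
def SuppPair (G : Multigraph) (z a b : G.V) : Prop :=
  ∃ e1 e2 : G.E, e1 ≠ e2 ∧ G.ends e1 = s(z, a) ∧ G.ends e2 = s(z, b) ∧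
    ∀ e : G.E, z ∈ G.ends e → e = e1 ∨ e = e2

/-- `M'` is obtained from `M` by suppressing one peripheral vertex of degree at
most two (deleting any resulting loop). -/
def Suppresses (M M' : MarkedGraph) : Prop :=
  ∃ z : M.G.V, z ∉ M.core ∧ M.G.degree z ≤ 2 ∧
    ∃ fV : M'.G.V ≃ {v : M.G.V // v ≠ z},
      (∀ w : M'.G.V, w ∈ M'.core ↔ (fV w).1 ∈ M.core) ∧
      ((¬ (∃ a b : M.G.V, a ≠ b ∧ SuppPair M.G z a b) ∧
          ∃ fE : M'.G.E ≃ {e : M.G.E // z ∉ M.G.ends e},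
            ∀ e : M'.G.E, Sym2.map (fun w => (fV w).1) (M'.G.ends e) = M.G.ends (fE e).1) ∨
        (∃ a b : M.G.V, a ≠ b ∧ SuppPair M.G z a b ∧
          ∃ fE : M'.G.E ≃ ({e : M.G.E // z ∉ M.G.ends e} ⊕ Unit),
            ∀ e : M'.G.E, Sym2.map (fun w => (fV w).1) (M'.G.ends e) =
              Sum.elim (fun e' : {e : M.G.E // z ∉ M.G.ends e} => M.G.ends e'.1)
                (fun _ => s(a, b)) (fE e)))

/-- No peripheral vertex can be suppressed any more. -/
def MarkedGraph.Terminal (M : MarkedGraph) : Prop :=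
  ∀ z : M.G.V, z ∉ M.core → 2 < M.G.degree z

namespace TreeCutDecomp

variable {G : Multigraph}

/-- `X_{T_{ab}}`: the union of the bags on the side of `a` of the tree edge `ab`. -/
def side (D : TreeCutDecomp G) (a b : D.N) : Set G.V :=
  {v | (D.T.deleteEdges {s(a, b)}).Reachable (D.nodeOf v) a}

/-- The adhesion of the tree edge `ab`: the edges of `G` crossing between the
two sides. -/
def adh (D : TreeCutDecomp G) (a b : D.N) : Set G.E :=
  {e | ∃ u v : G.V, G.ends e = s(u, v) ∧ u ∈ D.side a b ∧ v ∈ D.side b a}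

/-- `w(t) = |X_t| + #{neighbours with bold adhesion}`. -/
def wval (D : TreeCutDecomp G) (t : D.N) : ℕ :=
  (D.bag t).card + {t' : D.N | D.T.Adj t t' ∧ 2 < (D.adh t t').ncard}.ncard

/-- The maximum adhesion size of the decomposition. -/
def maxAdh (D : TreeCutDecomp G) : ℕ :=
  Finset.univ.sup fun pq : D.N × D.N =>
    if D.T.Adj pq.1 pq.2 then (D.adh pq.1 pq.2).ncard else 0

/-- `width'` of a tree-cut decomposition. -/
def width' (D : TreeCutDecomp G) : ℕ :=
  max D.maxAdh (Finset.univ.sup fun t => D.wval t)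

/-- `z(t) = |X_t| + Σ_{e ∋ t, |adh(e)| ≥ 3} |adh(e)|`. -/
def zval (D : TreeCutDecomp G) (t : D.N) : ℕ :=
  (D.bag t).card + ∑ t' : D.N,
    if D.T.Adj t t' ∧ 3 ≤ (D.adh t t').ncard then (D.adh t t').ncard else 0

/-- `width''` of a tree-cut decomposition. -/
def width'' (D : TreeCutDecomp G) : ℕ := Finset.univ.sup fun t => D.zval t

/-- A tree-cut decomposition is connected if both sides of every tree edge
induce connected subgraphs of `G`. -/
def IsConnectedDecomp (D : TreeCutDecomp G) : Prop :=
  ∀ a b : D.N, D.T.Adj a b → G.ConnectedOn (D.side a b) ∧ G.ConnectedOn (D.side b a)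

/-- The vertex type of the torso at `t`: the core vertices (the bag at `t`)
together with one peripheral vertex for each component of `T - t` inside the
tree of `t` (equivalently, for each neighbour of `t`). -/
def TorsoV (D : TreeCutDecomp G) (t : D.N) : Type :=
  {v : G.V // v ∈ D.bag t} ⊕ {x : D.N // D.T.Adj t x}

/-- The projection of the vertices of `G` to the vertices of the torso at `t`
(defined on the connected component of `G` corresponding to the tree of `t`). -/
def torsoProj (D : TreeCutDecomp G) (t : D.N) (v : G.V) : Option (D.TorsoV t) :=
  if h : v ∈ D.bag t then some (Sum.inl ⟨v, h⟩)
  else if h2 : ∃ x : {x : D.N // D.T.Adj t x},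
      (D.T.deleteEdges {e : Sym2 D.N | t ∈ e}).Reachable (D.nodeOf v) x.1
    then some (Sum.inr h2.choose)
  else none

/-- The torso of the decomposition at the node `t` (as a multigraph): each
component of `T - t` is consolidated to a single peripheral vertex, and the
resulting loops are deleted. -/
instance instFintypeTorsoV (D : TreeCutDecomp G) (t : D.N) : Fintype (D.TorsoV t) := by
  unfold TorsoV; infer_instance

def torsoGraph (D : TreeCutDecomp G) (t : D.N) : Multigraph where
  V := D.TorsoV t
  E := {e : G.E // ∃ a b : D.TorsoV t, a ≠ b ∧
        Sym2.map (D.torsoProj t) (G.ends e) = s(some a, some b)}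
  fintypeV := inferInstance
  fintypeE := Fintype.ofFinite _
  ends := fun e => s(e.2.choose, e.2.choose_spec.choose)
  loopless := fun e hd => e.2.choose_spec.choose_spec.1 (Sym2.mk_isDiag_iff.mp hd)

/-- The torso at `t` as a marked graph: the core vertices are the vertices of
the bag at `t`. -/
def torso (D : TreeCutDecomp G) (t : D.N) : MarkedGraph where
  G := D.torsoGraph t
  core := Set.range (Sum.inl : {v : G.V // v ∈ D.bag t} → D.TorsoV t)

/-- The possible numbers of vertices of a 3-center at `t`: the sizes of the
terminal marked graphs obtained from the torso at `t` by exhaustively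
suppressing peripheral vertices of degree at most two. -/
def threeCenterSizes (D : TreeCutDecomp G) (t : D.N) : Set ℕ :=
  {n | ∃ M : MarkedGraph, Relation.ReflTransGen Suppresses (D.torso t) M ∧
    M.Terminal ∧ Fintype.card M.G.V = n}

/-- The width of a tree-cut decomposition: the maximum over all adhesion sizes
and all numbers of vertices of 3-centers. -/
def width (D : TreeCutDecomp G) : ℕ :=
  max D.maxAdh (Finset.univ.sup fun t => sSup (D.threeCenterSizes t))

/-- The component `T_{tp}` of `T - p` is connected with a neat adhesion to `p`:
the adhesion of `tp` is thin and all of its edges have an endpoint in `X_p`. -/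
def NeatAdhesionTo (D : TreeCutDecomp G) (p t : D.N) : Prop :=
  (D.adh t p).ncard ≤ 2 ∧ ∀ e ∈ D.adh t p, ∃ v ∈ D.bag p, v ∈ G.ends e

end TreeCutDecomp

/-- Tree-cut width (via the width with 3-centers). -/
def tcw (G : Multigraph) : ℕ := sInf {k | ∃ D : TreeCutDecomp G, D.width = k}

/-- Tree-cut width via `width'`. -/
def tcw' (G : Multigraph) : ℕ := sInf {k | ∃ D : TreeCutDecomp G, D.width' = k}

/-- A rooted tree-cut decomposition: every tree of the forest gets a root,
encoded by a parent function (roots are their own parents) together with a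
depth function certifying well-foundedness; the parent relation orients all
tree edges. -/
structure RootedTreeCutDecomp (G : Multigraph) extends TreeCutDecomp G where
  parent : N → N
  depth : N → ℕ
  parent_adj : ∀ t : N, parent t ≠ t → T.Adj t (parent t)
  depth_lt : ∀ t : N, parent t ≠ t → depth (parent t) < depth t
  parent_cover : ∀ t t' : N, T.Adj t t' → parent t = t' ∨ parent t' = t

namespace RootedTreeCutDecomp

variable {G : Multigraph}

/-- A rooted tree-cut decomposition is neat: it is connected, and for every
non-root node `t` whose adhesion to its parent is thin and every sibling `t'`
of `t`, there are no edges of `G` between `X_{T_{tπ(t)}}` and `X_{T_{t'π(t)}}`. -/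
def Neat (D : RootedTreeCutDecomp G) : Prop :=
  D.toTreeCutDecomp.IsConnectedDecomp ∧
  ∀ t : D.N, D.parent t ≠ t →
    (D.toTreeCutDecomp.adh t (D.parent t)).ncard ≤ 2 →
    ∀ t' : D.N, t' ≠ t → D.parent t' = D.parent t → D.parent t' ≠ t' →
      ∀ e : G.E, ¬ ∃ u v : G.V, G.ends e = s(u, v) ∧
        u ∈ D.toTreeCutDecomp.side t (D.parent t) ∧
        v ∈ D.toTreeCutDecomp.side t' (D.parent t')

end RootedTreeCutDecomp

/-- An `r`-protrusion: a set of vertices with boundary of size at most `r`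
inducing an `F`-immersion-free subgraph. -/
def IsProtrusion {ι : Type} (F : ι → Multigraph) (G : Multigraph) (r : ℕ) (X : Set G.V) : Prop :=
  (G.edgeBoundary X).ncard ≤ r ∧ FFreeOn F G X

/-- `B` is an excessive protrusion inside the connected component of `G`
containing it (with parameters `b = b_F` and `c = c_F`): it is a
`2b`-protrusion with more than `2bc` induced edges, whose removal from its
component leaves at most two connected components. -/
def IsExcessiveIn {ι : Type} (F : ι → Multigraph) (b c : ℕ) (G : Multigraph)
    (B : Set G.V) : Prop :=
  ∃ v₀ ∈ B, B ⊆ G.component v₀ ∧ IsProtrusion F G (2 * b) B ∧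
    2 * b * c < (G.inducedEdges B).ncard ∧ G.compCount (G.component v₀ \ B) ≤ 2

/-- Some connected component of `G` has an excessive protrusion. -/
def HasExcessive {ι : Type} (F : ι → Multigraph) (b c : ℕ) (G : Multigraph) : Prop :=
  ∃ B : Set G.V, IsExcessiveIn F b c G B

/-- `c` is a valid constant for the protrusion-replacement lemma with width
constant `b`. -/
def ReplacerConst {ι : Type} (F : ι → Multigraph) (b c : ℕ) : Prop :=
  ∀ (G : Multigraph) (X : Set G.V), IsProtrusion F G (2 * b) X →
    c < (G.inducedEdges X).ncard →
    ∃ G' : Multigraph, OPT F G' = OPT F G ∧ G'.numEdges < G.numEdges ∧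
      ∀ D' : Finset G'.E, FFree F (G'.deleteEdges D') →
        ∃ D : Finset G.E, FFree F (G.deleteEdges D) ∧ D.card ≤ D'.card

/-- `G[U ∪ A]` and `G[U ∪ B]` are isomorphic via an isomorphism mapping every
vertex of `U` to itself. -/
def InducedIsoFixing (G : Multigraph) (U A B : Set G.V) : Prop :=
  ∃ φ : G.V → G.V, Set.BijOn φ (U ∪ A) (U ∪ B) ∧ (∀ u ∈ U, φ u = u) ∧
    ∃ ψ : G.E → G.E, Set.BijOn ψ (G.inducedEdges (U ∪ A)) (G.inducedEdges (U ∪ B)) ∧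
      ∀ e ∈ G.inducedEdges (U ∪ A), G.ends (ψ e) = (G.ends e).map φ

/-- A family of pairwise disjoint, connected `2`-protrusions all attached to
`U` and pairwise isomorphic over `U`. -/
def IsBouquetFamily {ι : Type} (F : ι → Multigraph) (G : Multigraph) (U : Set G.V)
    (𝒮 : Set (Set G.V)) : Prop :=
  (∀ S ∈ 𝒮, S.Nonempty ∧ IsProtrusion F G 2 S ∧ G.nbhd S = U ∧ G.ConnectedOn S) ∧
  𝒮.Pairwise (fun S S' => Disjoint S S') ∧
  ∀ S ∈ 𝒮, ∀ S' ∈ 𝒮, InducedIsoFixing G U S S'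

/-- A bouquet attached to `U` (with threshold `d = d_F`): an inclusion-maximal
bouquet family with at least `d` elements. -/
def IsBouquet {ι : Type} (F : ι → Multigraph) (d : ℕ) (G : Multigraph) (U : Set G.V)
    (𝒮 : Set (Set G.V)) : Prop :=
  IsBouquetFamily F G U 𝒮 ∧ d ≤ 𝒮.ncard ∧
  ∀ 𝒮' : Set (Set G.V), 𝒮 ⊆ 𝒮' → IsBouquetFamily F G U 𝒮' → 𝒮' = 𝒮

/-- The edge set of a bouquet: all edges incident to some element of it. -/
def Multigraph.bouquetEdges (G : Multigraph) (𝒮 : Set (Set G.V)) : Set G.E :=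
  {e | ∃ S ∈ 𝒮, ∃ v ∈ G.ends e, v ∈ S}

/-- A theta attached to `{u, v}` (with threshold `d = d_F`): `u` and `v` are
joined by at least `d` parallel edges (the theta itself being the maximal set
of all parallel edges between them). -/
def IsTheta (d : ℕ) (G : Multigraph) (u v : G.V) : Prop :=
  u ≠ v ∧ d ≤ (G.parallelEdges u v).ncard

/-- The constant `d_F = max(2 b_F c_F + 2 b_F, 3 MAX_F) + 1`. -/
def dConst {ι : Type} [Fintype ι] (F : ι → Multigraph) (b c : ℕ) : ℕ :=
  max (2 * b * c + 2 * b) (3 * maxEdges F) + 1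

/-- An `r`-boundaried graph. -/
structure BGraph (r : ℕ) : Type 1 where
  G : Multigraph
  bnd : Fin r → G.V

/-- Gluing two `r`-boundaried graphs: take the disjoint union and add one edge
joining the `i`-th boundary vertices, for each `i`. -/
def glue {r : ℕ} (A B : BGraph r) : Multigraph where
  V := A.G.V ⊕ B.G.V
  E := (A.G.E ⊕ B.G.E) ⊕ Fin r
  fintypeV := Fintype.ofFinite _
  fintypeE := Fintype.ofFinite _
  ends := Sum.elim
    (Sum.elim (fun e => (A.G.ends e).map Sum.inl) (fun e => (B.G.ends e).map Sum.inr))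
    (fun i => s(Sum.inl (A.bnd i), Sum.inr (B.bnd i)))
  loopless := by
    rintro ((e | e) | i) h
    · exact sym2_map_not_isDiag Sum.inl_injective (A.G.loopless e) h
    · exact sym2_map_not_isDiag Sum.inr_injective (B.G.loopless e) h
    · simp only [Sum.elim_inr, Sym2.mk_isDiag_iff] at h
      exact Sum.inl_ne_inr h

/-- The extended graph `Ĝ` of an `r`-boundaried graph: add a new pendant vertex
`û_i` adjacent exactly to the `i`-th boundary vertex, for each `i`. -/
def BGraph.extend {r : ℕ} (A : BGraph r) : Multigraph where
  V := A.G.V ⊕ Fin r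
  E := A.G.E ⊕ Fin r
  fintypeV := Fintype.ofFinite _
  fintypeE := Fintype.ofFinite _
  ends := Sum.elim (fun e => (A.G.ends e).map Sum.inl)
    (fun i => s(Sum.inl (A.bnd i), Sum.inr i))
  loopless := by
    rintro (e | i) h
    · exact sym2_map_not_isDiag Sum.inl_injective (A.G.loopless e) h
    · simp only [Sum.elim_inr, Sym2.mk_isDiag_iff] at h
      exact Sum.inl_ne_inr h

/-- A relevant pair `(Q, φ)`: a graph with at most `(r+1)·MAX_F` edges and no
isolated vertices together with a nonempty partial map from its vertices to `[r]`. -/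
def RelevantPair (r m : ℕ) (Q : Multigraph) (φ : Q.V → Option (Fin r)) : Prop :=
  Q.numEdges ≤ (r + 1) * m ∧ (∀ v : Q.V, ∃ e : Q.E, v ∈ Q.ends e) ∧ ∃ v i, φ v = some i

/-- `Ĝ - D` admits a `φ`-rooted immersion model of `Q`: an immersion model of
`Q` mapping every vertex in the domain of `φ` to the corresponding copy `û_i`. -/
def HasRootedModel {r : ℕ} (A : BGraph r) (D : Finset A.extend.E)
    (Q : Multigraph) (φ : Q.V → Option (Fin r)) : Prop :=
  ∃ M : Immersion Q (A.extend.deleteEdges D),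
    ∀ (v : Q.V) (i : Fin r), φ v = some i → M.vmap v = Sum.inr i

/-- The deletion number of an `r`-boundaried graph with respect to a set `S` of
relevant pairs: the minimum number of edges of `Ĝ` whose deletion leaves no
`φ`-rooted immersion model of `Q`, for every `(Q, φ) ∈ S`. -/
def delNum {r : ℕ} (A : BGraph r)
    (S : ∀ Q : Multigraph, (Q.V → Option (Fin r)) → Prop) : ℕ :=
  sInf {k | ∃ D : Finset A.extend.E, D.card = k ∧
    ∀ (Q : Multigraph) (φ : Q.V → Option (Fin r)), S Q φ → ¬ HasRootedModel A D Q φ}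

/-- Two `r`-boundaried graphs have the same signature: their deletion numbers
agree on every set of relevant pairs. -/
def SameSig {r : ℕ} (m : ℕ) (A B : BGraph r) : Prop :=
  ∀ S : ∀ Q : Multigraph, (Q.V → Option (Fin r)) → Prop,
    (∀ Q φ, S Q φ → RelevantPair r m Q φ) → delNum A S = delNum B S

/-- `F`-equivalence of `r`-boundaried graphs. -/
def FEquiv {ι : Type} (F : ι → Multigraph) {r : ℕ} (A B : BGraph r) : Prop :=
  ∀ C : BGraph r, OPT F (glue A C) = OPT F (glue B C)

namespace Multigraph

section Reach

variable {G : Multigraph} {S T W : Set G.V} {u v w : G.V}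

theorem Walk.start_mem_support (p : Walk G u v) : u ∈ p.support := by
  cases p <;> simp [Walk.support]

theorem ReachIn.refl (h : u ∈ S) : G.ReachIn S u u :=
  ⟨.nil u, by simpa [Walk.support] using h⟩

theorem ReachIn.cons {e : G.E} (he : G.ends e = s(u, v)) (hu : u ∈ S)
    (h : G.ReachIn S v w) : G.ReachIn S u w := by
  obtain ⟨p, hp⟩ := h
  refine ⟨.cons e he p, fun x hx => ?_⟩
  rcases List.mem_cons.1 hx with rfl | hx
  exacts [hu, hp x hx]

theorem ReachIn.mem_left (h : G.ReachIn S u v) : u ∈ S :=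
  h.choose_spec _ h.choose.start_mem_support

theorem ReachIn.edge {e : G.E} (he : G.ends e = s(u, v)) (hu : u ∈ S) (hv : v ∈ S) :
    G.ReachIn S u v :=
  .cons he hu (.refl hv)

theorem ReachIn.head_induction {P : G.V → Prop} (h : G.ReachIn S u v)
    (base : v ∈ S → P v)
    (step : ∀ x y (e : G.E), G.ends e = s(x, y) → x ∈ S → G.ReachIn S y v → P y → P x) : P u := by
  obtain ⟨p, hp⟩ := h
  induction p with
  | nil a => exact base (hp _ (by simp [Walk.support]))
  | cons e he p ih =>
    have hp' : ∀ x ∈ p.support, x ∈ S := fun x hx => hp x (List.mem_cons_of_mem _ hx)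
    exact step _ _ e he (hp _ List.mem_cons_self) ⟨p, hp'⟩ (ih base step hp')

theorem ReachIn.mem_right (h : G.ReachIn S u v) : v ∈ S :=
  h.head_induction (P := fun _ => v ∈ S) id fun _ _ _ _ _ _ h => h

theorem ReachIn.trans (h : G.ReachIn S u v) (h' : G.ReachIn S v w) : G.ReachIn S u w :=
  h.head_induction (P := fun x => G.ReachIn S x w) (fun _ => h')
    fun _ _ _ he hx _ ih => ReachIn.cons he hx ih

theorem ReachIn.symm (h : G.ReachIn S u v) : G.ReachIn S v u :=
  h.head_induction (P := fun x => G.ReachIn S v x) .refl fun _ _ _ he hx _ ih =>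
    ih.trans (.edge (he.trans Sym2.eq_swap) ih.mem_right hx)

theorem ReachIn.mono (hST : S ⊆ T) (h : G.ReachIn S u v) : G.ReachIn T u v := by
  obtain ⟨p, hp⟩ := h
  exact ⟨p, fun x hx => hST (hp x hx)⟩

theorem reachIn_univ : G.ReachIn Set.univ u v ↔ G.Reachable u v :=
  ⟨fun ⟨p, _⟩ => ⟨p⟩, fun ⟨p⟩ => ⟨p, fun _ _ => trivial⟩⟩

/-- A walk inside `S` leaving a set `C` uses an edge leaving `C`. -/
theorem ReachIn.exists_exit (h : G.ReachIn S u v) {C : Set G.V} (hu : u ∈ C) (hv : v ∉ C) :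
    ∃ (e : G.E) (x y : G.V), G.ends e = s(x, y) ∧ x ∈ C ∧ y ∉ C ∧ G.ReachIn S y v ∧ x ∈ S := by
  revert hu
  refine h.head_induction (P := fun u => u ∈ C → _) (fun _ h => absurd h hv) ?_
  intro x y e he hx hy ih hxC
  by_cases hyC : y ∈ C
  · exact ih hyC
  · exact ⟨e, x, y, he, hxC, hyC, hy, hx⟩

/-- A walk inside `S` starting in a set that is closed in `S` under adjacency stays there. -/
theorem ReachIn.inter (h : G.ReachIn S u v) {C : Set G.V} (hu : u ∈ C)
    (hC : ∀ (e : G.E) x y, G.ends e = s(x, y) → x ∈ C → x ∈ S → y ∈ S → y ∈ C) :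
    G.ReachIn (S ∩ C) u v := by
  revert hu
  refine h.head_induction (P := fun u => u ∈ C → G.ReachIn (S ∩ C) u v)
    (fun hS h => .refl ⟨hS, h⟩) ?_
  intro x y e he hx hy ih hxC
  exact .cons he ⟨hx, hxC⟩ (ih (hC e x y he hxC hx hy.mem_left))

/-- The vertices that can be reached from `v` inside `S`. -/
def reachSet (G : Multigraph) (S : Set G.V) (v : G.V) : Set G.V := {w | G.ReachIn S v w}

theorem reachSet_subset : G.reachSet S v ⊆ S := fun _ h => ReachIn.mem_right h

theorem connectedOn_reachSet : G.ConnectedOn (G.reachSet S v) := by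
  have key : ∀ x ∈ G.reachSet S v, G.ReachIn (G.reachSet S v) v x := by
    intro x hx
    refine (ReachIn.inter hx (.refl hx.mem_left) ?_).mono Set.inter_subset_right
    intro e y z he hy hyS hzS
    exact ReachIn.trans hy (.edge he hyS hzS)
  intro x hx y hy
  exact (key x hx).symm.trans (key y hy)

theorem mem_reachSet_of_edge {e : G.E} (he : G.ends e = s(u, w)) (hu : u ∈ G.reachSet S v)
    (hw : w ∈ S) : w ∈ G.reachSet S v :=
  ReachIn.trans hu (.edge he (ReachIn.mem_right hu) hw)

theorem edgeBoundary_reachSet_subset : G.edgeBoundary (G.reachSet S v) ⊆ G.edgeBoundary S := by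
  rintro e ⟨x, y, he, hx, hy⟩
  exact ⟨x, y, he, reachSet_subset hx, fun hyS => hy (mem_reachSet_of_edge he hx hyS)⟩

theorem nbhd_reachSet_subset : G.nbhd (G.reachSet S v) ⊆ G.nbhd S := by
  rintro x ⟨hx, e, y, hy, he⟩
  exact ⟨fun hxS => hx (mem_reachSet_of_edge (he.trans Sym2.eq_swap) hy hxS), e, y,
    reachSet_subset hy, he⟩

theorem Connected.reachIn_univ (h : G.Connected) (u v : G.V) : G.ReachIn Set.univ u v :=
  Multigraph.reachIn_univ.2 (h.2 u v)

end Reach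

section Branching

variable {G : Multigraph}

/-- At least three components of `G - W` contain an element of `M`. -/
def Branching (G : Multigraph) (M W : Set G.V) : Prop :=
  ∃ f : Fin 3 → G.V, (∀ i, f i ∈ M ∧ f i ∉ W) ∧ ∀ i j, i ≠ j → ¬ G.ReachIn Wᶜ (f i) (f j)

theorem Branching.nonempty {M W : Set G.V} (hG : G.Connected) (h : G.Branching M W) :
    W.Nonempty := by
  obtain ⟨f, -, hf⟩ := h
  by_contra hW
  rw [Set.not_nonempty_iff_eq_empty] at hW
  subst hW
  exact hf 0 1 (by decide) ((hG.reachIn_univ _ _).mono (by simp))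

/-- A vertex outside `W` reaches `W` while avoiding any other component of `G - W`. -/
theorem exists_reachIn_compl_reachSet (hG : G.Connected) {W : Set G.V} (hne : W.Nonempty)
    {v x : G.V} (hx : x ∉ W) (hxv : ¬ G.ReachIn Wᶜ v x) :
    ∃ y ∈ W, G.ReachIn (G.reachSet Wᶜ v)ᶜ x y := by
  obtain ⟨w, hw⟩ := hne
  obtain ⟨e, p, q, he, hp, hq, -, -⟩ := (hG.reachIn_univ x w).exists_exit
    (C := G.reachSet Wᶜ x) (.refl hx) (fun h => reachSet_subset h hw)
  have hqW : q ∈ W := by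
    by_contra hqW
    exact hq (mem_reachSet_of_edge he hp hqW)
  have hsub : G.reachSet Wᶜ x ⊆ (G.reachSet Wᶜ v)ᶜ := fun y hy hy' =>
    hxv (ReachIn.trans hy' (ReachIn.symm hy))
  have hq' : q ∈ (G.reachSet Wᶜ v)ᶜ := fun h => reachSet_subset h hqW
  refine ⟨q, hqW, ReachIn.trans ((connectedOn_reachSet x (.refl hx) p hp).mono hsub)
    (.edge he (hsub hp) hq')⟩

/-- Disjoint connected branching sets are at most as many as the marked vertices. -/
theorem card_branching_le (hG : G.Connected) (s : Finset (Set G.V)) :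
    ∀ M : Finset G.V, (∀ W ∈ s, G.ConnectedOn W ∧ G.Branching M W) →
      (s : Set (Set G.V)).PairwiseDisjoint id → s.card ≤ M.card := by
  induction s using Finset.strongInduction with
  | H s ih =>
  intro M hs hd
  rcases s.eq_empty_or_nonempty with rfl | ⟨W₀, hW₀⟩
  · simp
  obtain ⟨⟨W, v⟩, hWv, hmax⟩ : ∃ p ∈ ({p : Set G.V × G.V | p.1 ∈ s ∧ p.2 ∉ p.1} : Set _),
      ∀ q ∈ ({p : Set G.V × G.V | p.1 ∈ s ∧ p.2 ∉ p.1} : Set _),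
        (G.reachSet q.1ᶜ q.2).ncard ≤ (G.reachSet p.1ᶜ p.2).ncard := by
    obtain ⟨f, hf, -⟩ := (hs W₀ hW₀).2
    exact Set.exists_max_image _ (fun p : Set G.V × G.V => (G.reachSet p.1ᶜ p.2).ncard)
      (Set.toFinite _) ⟨(W₀, f 0), hW₀, (hf 0).2⟩
  obtain ⟨hW, hv⟩ : W ∈ s ∧ v ∉ W := hWv
  have hWne := (hs W hW).2.nonempty hG
  set K := G.reachSet Wᶜ v with hK
  have hother : ∀ W' ∈ s, W' ≠ W → W' ⊆ K := by
    intro W' hW' hne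
    have hdis : Disjoint W' W := hd hW' hW hne
    by_contra hcon
    obtain ⟨w', hw', hw'K⟩ := Set.not_subset.1 hcon
    have hdK : ∀ k ∈ K, k ∉ W' := fun k hk hkW' =>
      hw'K (ReachIn.trans hk (((hs W' hW').1 k hkW' w' hw').mono
        (Set.subset_compl_iff_disjoint_right.2 hdis)))
    have hWW' : W ⊆ W'ᶜ := Set.subset_compl_iff_disjoint_right.2 hdis.symm
    obtain ⟨w, hw⟩ := hWne
    have hvK : v ∈ K := ReachIn.refl hv
    obtain ⟨e, x, y, he, hx, hy, -, -⟩ := (hG.reachIn_univ v w).exists_exit (C := K)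
      hvK (fun h => reachSet_subset h hw)
    have hyW : y ∈ W := by
      by_contra h
      exact hy (mem_reachSet_of_edge he hx h)
    have hKsub : K ⊆ G.reachSet W'ᶜ v := fun k hk =>
      (connectedOn_reachSet v hvK k hk).mono hdK
    have hyr : y ∈ G.reachSet W'ᶜ v := mem_reachSet_of_edge he (hKsub hx) (hWW' hyW)
    have hss : K ⊂ G.reachSet W'ᶜ v := ⟨hKsub, fun h => hy (h hyr)⟩
    exact absurd (hmax (W', v) ⟨hW', hdK v hvK⟩) (not_le.2 (Set.ncard_lt_ncard hss))
  obtain ⟨f, hfM, hf⟩ := (hs W hW).2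
  obtain ⟨i, j, hij, hi, hj⟩ : ∃ i j, i ≠ j ∧ f i ∉ K ∧ f j ∉ K := by
    by_contra hcon
    push Not at hcon
    have h2 : ∀ i j, i ≠ j → f i ∈ K → f j ∉ K := fun i j hij hi hj =>
      hf i j hij (ReachIn.trans (ReachIn.symm hi) hj)
    have h01 := hcon 0 1 (by decide)
    have h02 := hcon 0 2 (by decide)
    have h12 := hcon 1 2 (by decide)
    have := h2 0 1 (by decide)
    have := h2 0 2 (by decide)
    have := h2 1 2 (by decide)
    tauto
  have hreach : G.ReachIn Kᶜ (f i) (f j) := by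
    obtain ⟨p, hp, hip⟩ := exists_reachIn_compl_reachSet hG hWne (hfM i).2 hi
    obtain ⟨q, hq, hjq⟩ := exists_reachIn_compl_reachSet hG hWne (hfM j).2 hj
    exact (hip.trans (((hs W hW).1 p hp q hq).mono
      (fun x hx hxK => reachSet_subset hxK hx))).trans hjq.symm
  have hne : f j ≠ f i := fun h => hf i j hij (h.symm ▸ ReachIn.refl (hfM i).2)
  have hcard := ih (s.erase W) (Finset.erase_ssubset hW) (M.erase (f i)) ?_
    (hd.subset (by simp))
  · rw [Finset.card_erase_of_mem hW, Finset.card_erase_of_mem (hfM i).1] at hcard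
    have : 0 < M.card := Finset.card_pos.2 ⟨_, (hfM i).1⟩
    omega
  · intro W' hW'
    obtain ⟨hW'ne, hW's⟩ := Finset.mem_erase.1 hW'
    have hsub := hother W' hW's hW'ne
    refine ⟨(hs W' hW's).1, ?_⟩
    obtain ⟨g, hgM, hg⟩ := (hs W' hW's).2
    have hr : G.ReachIn W'ᶜ (f i) (f j) := hreach.mono (Set.compl_subset_compl.2 hsub)
    have hgr : ∀ k, G.ReachIn W'ᶜ (g k) (if g k = f i then f j else g k) := by
      intro k
      split_ifs with h
      · rw [h]; exact hr
      · exact .refl (hgM k).2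
    refine ⟨fun k => if g k = f i then f j else g k, fun k => ⟨?_, (hgr k).mem_right⟩, ?_⟩
    · dsimp only
      split_ifs with h
      · simpa [hne] using (hfM j).1
      · simpa [h] using (hgM k).1
    · intro k l hkl h
      exact hg k l hkl (((hgr k).trans h).trans (hgr l).symm)

end Branching

end Multigraph

namespace Multigraph

section Tame

variable {H : Multigraph} {ν : Set H.V → ℕ}

theorem mem_inducedEdges_iff {X : Set H.V} {e : H.E} {u v : H.V} (he : H.ends e = s(u, v)) :
    e ∈ H.inducedEdges X ↔ u ∈ X ∧ v ∈ X := by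
  simp [inducedEdges, he]

theorem exists_ends (H : Multigraph) (e : H.E) : ∃ u v, H.ends e = s(u, v) := by
  induction h : H.ends e using Sym2.ind with
  | _ x y => exact ⟨x, y, rfl⟩

theorem edgeBoundary_union_subset (X Y : Set H.V) :
    H.edgeBoundary (X ∪ Y) ⊆ H.edgeBoundary X ∪ H.edgeBoundary Y := by
  rintro e ⟨u, v, he, hu | hu, hv⟩
  · exact .inl ⟨u, v, he, hu, fun h => hv (.inl h)⟩
  · exact .inr ⟨u, v, he, hu, fun h => hv (.inr h)⟩

theorem edgeBoundary_diff_subset {X Y : Set H.V} :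
    H.edgeBoundary (X \ Y) ⊆ H.edgeBoundary X ∪ H.edgeBoundary Y := by
  rintro e ⟨u, v, he, hu, hv⟩
  by_cases hvX : v ∈ X
  · exact .inr ⟨v, u, he.trans Sym2.eq_swap, by_contra fun h => hv ⟨hvX, h⟩, hu.2⟩
  · exact .inl ⟨u, v, he, hu.1, hvX⟩

theorem inducedEdges_subset_diff (X Y : Set H.V) :
    H.inducedEdges X ⊆ H.inducedEdges Y ∪ H.inducedEdges (X \ Y) ∪ H.edgeBoundary Y := by
  intro e hX
  obtain ⟨u, v, he⟩ := H.exists_ends e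
  obtain ⟨hu, hv⟩ := (mem_inducedEdges_iff he).1 hX
  by_cases huY : u ∈ Y <;> by_cases hvY : v ∈ Y
  · exact .inl (.inl ((mem_inducedEdges_iff he).2 ⟨huY, hvY⟩))
  · exact .inr ⟨u, v, he, huY, hvY⟩
  · exact .inr ⟨v, u, he.trans Sym2.eq_swap, hvY, huY⟩
  · exact .inl (.inr ((mem_inducedEdges_iff he).2 ⟨⟨hu, huY⟩, hv, hvY⟩))

theorem edgeBoundary_empty : H.edgeBoundary ∅ = ∅ := by
  ext e; simp [edgeBoundary]

theorem inducedEdges_empty : H.inducedEdges ∅ = ∅ := by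
  ext e
  obtain ⟨u, v, he⟩ := H.exists_ends e
  simp [mem_inducedEdges_iff he]

/-- Superadditivity of a set function over disjoint unions. -/
def Superadditive (ν : Set H.V → ℕ) : Prop :=
  ∀ X Y : Set H.V, Disjoint X Y → ν X + ν Y ≤ ν (X ∪ Y)

theorem Superadditive.mono (hν : Superadditive ν) {X Y : Set H.V} (h : X ⊆ Y) : ν X ≤ ν Y := by
  have := hν X (Y \ X) Set.disjoint_sdiff_right
  rw [Set.union_sdiff_cancel h] at this
  omega

theorem Superadditive.empty (hν : Superadditive ν) : ν ∅ = 0 := by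
  have := hν ∅ ∅ (by simp)
  simp only [Set.union_empty] at this
  omega

theorem Superadditive.sum_le (hν : Superadditive ν) {s : Finset (Set H.V)}
    (hd : (s : Set (Set H.V)).PairwiseDisjoint id) {X : Set H.V} (hX : ∀ S ∈ s, S ⊆ X) :
    ∑ S ∈ s, ν S ≤ ν X := by
  refine le_trans ?_ (hν.mono (Set.iUnion₂_subset hX))
  clear hX
  induction s using Finset.induction_on with
  | empty => simp
  | insert S s hS ih =>
    rw [Finset.sum_insert hS, Finset.set_biUnion_insert]
    refine le_trans (Nat.add_le_add_left (ih (hd.subset (by simp))) _) (hν _ _ ?_)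
    rw [Set.disjoint_iUnion₂_right]
    intro T hT
    exact hd (by simp) (by simp [hT]) (fun h => hS (h ▸ hT))

/-- Either `X` carries no charge, or it contains a set of the same charge, and of small boundary,
whose number of edges is at most linear in the charge. -/
def IsTame (H : Multigraph) (ν : Set H.V → ℕ) (a A C : ℕ) (X : Set H.V) : Prop :=
  (H.edgeBoundary X).ncard ≤ a ∧ (ν X = 0 ∨ ∃ Y ⊆ X, (H.edgeBoundary Y).ncard ≤ a ∧
    ν Y = ν X ∧ (H.inducedEdges Y).ncard + C ≤ A * ν X)

theorem IsTame.ncard_inducedEdges_add_le {a A C K : ℕ} {X : Set H.V} (hν : Superadditive ν)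
    (hK : ∀ X, ν X = 0 → (H.edgeBoundary X).ncard ≤ 2 * a → (H.inducedEdges X).ncard ≤ K)
    (h : H.IsTame ν a A C X) (h0 : ν X ≠ 0) :
    (H.inducedEdges X).ncard + C ≤ A * ν X + (K + a) := by
  obtain ⟨hX, h | ⟨Y, hYX, hY, hνY, hE⟩⟩ := h
  · exact absurd h h0
  have h1 := hν Y (X \ Y) Set.disjoint_sdiff_right
  rw [Set.union_sdiff_cancel hYX] at h1
  have h2 : (H.edgeBoundary (X \ Y)).ncard ≤ 2 * a := by
    have := (Set.ncard_le_ncard (edgeBoundary_diff_subset (X := X) (Y := Y))).trans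
      (Set.ncard_union_le _ _)
    omega
  have h3 := hK (X \ Y) (by omega) h2
  have h4 := ((Set.ncard_le_ncard (inducedEdges_subset_diff X Y)).trans
    (Set.ncard_union_le _ _)).trans (Nat.add_le_add_right (Set.ncard_union_le _ _) _)
  omega

/-- The constant by which the edges of a tame set are fewer than its charge allows. -/
def tameSlack (a K L n : ℕ) : ℕ := 2 * (K + 2 * a) + n * (K + 2 * a) + L

theorem inducedEdges_subset_of_eq_union {X Z : Set H.V} {s : Finset (Set H.V)}
    (hX : X = Z ∪ ⋃ S ∈ s, S) : H.inducedEdges X ⊆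
      H.inducedEdges Z ∪ ⋃ S ∈ s, (H.inducedEdges S ∪ H.edgeBoundary S) := by
  intro e heX
  obtain ⟨u, v, he⟩ := H.exists_ends e
  obtain ⟨hu, hv⟩ := (mem_inducedEdges_iff he).1 heX
  have key : ∀ u v, H.ends e = s(u, v) → ∀ S ∈ s, u ∈ S →
      e ∈ ⋃ S ∈ s, (H.inducedEdges S ∪ H.edgeBoundary S) := by
    intro u v he S hS hu
    refine Set.mem_iUnion₂.2 ⟨S, hS, ?_⟩
    by_cases hv : v ∈ S
    · exact .inl ((mem_inducedEdges_iff he).2 ⟨hu, hv⟩)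
    · exact .inr ⟨u, v, he, hu, hv⟩
  rw [hX] at hu hv
  rcases hu with hu | hu
  · rcases hv with hv | hv
    · exact .inl ((mem_inducedEdges_iff he).2 ⟨hu, hv⟩)
    · obtain ⟨S, hS, hv⟩ := Set.mem_iUnion₂.1 hv
      exact .inr (key v u (he.trans Sym2.eq_swap) S hS hv)
  · obtain ⟨S, hS, hu⟩ := Set.mem_iUnion₂.1 hu
    exact .inr (key u v he S hS hu)

/-- A set of small boundary that splits into tame sets and a set with few edges is tame, provided
that only few of the parts carry no charge. -/
theorem isTame_of_eq_union {a K L n : ℕ} {X Z : Set H.V} {s : Finset (Set H.V)}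
    (hν : Superadditive ν)
    (hK : ∀ X, ν X = 0 → (H.edgeBoundary X).ncard ≤ 2 * a → (H.inducedEdges X).ncard ≤ K)
    (hX : X = Z ∪ ⋃ S ∈ s, S) (hd : (s : Set (Set H.V)).PairwiseDisjoint id)
    (hδ : (H.edgeBoundary X).ncard ≤ a) (hZ : (H.inducedEdges Z).ncard ≤ L)
    (hs : ∀ S ∈ s, H.IsTame ν a (2 * tameSlack a K L n) (tameSlack a K L n) S)
    (hn : (s.filter fun S => S.Nonempty ∧ ν S = 0).card ≤ n) :
    H.IsTame ν a (2 * tameSlack a K L n) (tameSlack a K L n) X := by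
  set C := tameSlack a K L n with hC
  set R := K + 2 * a with hR
  have hCR : C = 2 * R + n * R + L := hC
  refine ⟨hδ, ?_⟩
  by_cases hX0 : ν X = 0
  · exact .inl hX0
  right
  have hsub : ∀ S ∈ s, S ⊆ X := fun S hS => hX ▸
    (Set.subset_biUnion_of_mem (u := fun S => S) hS).trans Set.subset_union_right
  set c : Set H.V → ℕ := fun S => (H.inducedEdges S ∪ H.edgeBoundary S).ncard with hc
  have hE : (H.inducedEdges X).ncard ≤ L + ∑ S ∈ s, c S := by
    refine (Set.ncard_le_ncard (inducedEdges_subset_of_eq_union hX)).trans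
      ((Set.ncard_union_le _ _).trans (Nat.add_le_add hZ (Finset.set_ncard_biUnion_le _ _)))
  have hcS : ∀ S, c S ≤ (H.inducedEdges S).ncard + (H.edgeBoundary S).ncard :=
    fun S => Set.ncard_union_le _ _
  have h0 : ∑ S ∈ s.filter (fun S => ν S = 0), c S ≤ n * R := by
    have : ∑ S ∈ s.filter (fun S => ν S = 0), c S
        = ∑ S ∈ s.filter (fun S => S.Nonempty ∧ ν S = 0), c S := by
      symm
      refine Finset.sum_subset (fun S hS => ?_) (fun S hS hS' => ?_)
      · simp only [Finset.mem_filter] at hS ⊢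
        exact ⟨hS.1, hS.2.2⟩
      · simp only [Finset.mem_filter, not_and] at hS hS'
        have : S = ∅ := by
          by_contra h
          exact hS' hS.1 (Set.nonempty_iff_ne_empty.2 h) hS.2
        simp [hc, this, inducedEdges_empty, edgeBoundary_empty]
    rw [this]
    refine (Finset.sum_le_card_nsmul _ _ R fun S hS => ?_).trans
      (by rw [smul_eq_mul]; exact Nat.mul_le_mul_right _ hn)
    simp only [Finset.mem_filter] at hS
    have h1 := (hs S hS.1).1
    have h2 := hK S hS.2.2 (by omega)
    have := hcS S
    omega
  set t := s.filter (fun S => ¬ ν S = 0) with ht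
  have h1 : ∑ S ∈ t, c S + t.card * C ≤ 2 * C * ∑ S ∈ t, ν S + t.card * R := by
    rw [Finset.mul_sum, ← smul_eq_mul t.card, ← smul_eq_mul t.card, ← Finset.sum_const,
      ← Finset.sum_const, ← Finset.sum_add_distrib, ← Finset.sum_add_distrib]
    refine Finset.sum_le_sum fun S hS => ?_
    simp only [ht, Finset.mem_filter] at hS
    have h1 := (hs S hS.1).1
    have h2 := (hs S hS.1).ncard_inducedEdges_add_le hν hK hS.2
    have := hcS S
    omega
  have hsum : ∑ S ∈ t, ν S ≤ ν X :=
    hν.sum_le (hd.subset (Finset.coe_subset.2 (Finset.filter_subset _ _)))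
      (fun S hS => hsub S (Finset.filter_subset _ _ hS))
  have hsplit : ∑ S ∈ s, c S = ∑ S ∈ s.filter (fun S => ν S = 0), c S + ∑ S ∈ t, c S :=
    (Finset.sum_filter_add_sum_filter_not _ _ _).symm
  have hmul : 2 * C * ∑ S ∈ t, ν S ≤ 2 * C * ν X := Nat.mul_le_mul_left _ hsum
  have hpos : 2 * C * 1 ≤ 2 * C * ν X := Nat.mul_le_mul_left _ (by omega)
  rcases Nat.lt_or_ge t.card 2 with hq | hq
  · rcases Nat.lt_or_ge t.card 1 with hq' | hq'
    · have : t = ∅ := Finset.card_eq_zero.1 (by omega)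
      simp only [this, Finset.sum_empty] at hsplit
      exact ⟨X, subset_rfl, hδ, rfl, by omega⟩
    · obtain ⟨S, hS⟩ := Finset.card_eq_one.1 (show t.card = 1 by omega)
      have hSt : S ∈ t := by simp [hS]
      have hSs := (Finset.mem_filter.1 hSt).1
      by_cases hSX : ν S = ν X
      · obtain ⟨-, h | ⟨Y, hY⟩⟩ := hs S hSs
        · omega
        · exact ⟨Y, hY.1.trans (hsub S hSs), hY.2.1, hY.2.2.1.trans hSX, hSX ▸ hY.2.2.2⟩
      · simp only [hS, Finset.sum_singleton, Finset.card_singleton, one_mul] at h1 hsum hsplit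
        have : 2 * C * (ν S + 1) ≤ 2 * C * ν X := Nat.mul_le_mul_left _ (by omega)
        rw [Nat.mul_add] at this
        exact ⟨X, subset_rfl, hδ, rfl, by omega⟩
  · obtain ⟨q, hq⟩ := Nat.exists_eq_add_of_le hq
    rw [hq] at h1
    have h3 : q * R ≤ q * C := Nat.mul_le_mul_left _ (by omega)
    rw [Nat.add_mul, Nat.add_mul] at h1
    exact ⟨X, subset_rfl, hδ, rfl, by omega⟩

/-- Disjoint tame sets whose union has a small boundary have a tame union. -/
theorem IsTame.union {a K L n : ℕ} {X Y : Set H.V} (hν : Superadditive ν)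
    (hK : ∀ X, ν X = 0 → (H.edgeBoundary X).ncard ≤ 2 * a → (H.inducedEdges X).ncard ≤ K)
    (hn : 2 ≤ n) (hd : Disjoint X Y)
    (hX : H.IsTame ν a (2 * tameSlack a K L n) (tameSlack a K L n) X)
    (hY : H.IsTame ν a (2 * tameSlack a K L n) (tameSlack a K L n) Y)
    (hδ : (H.edgeBoundary (X ∪ Y)).ncard ≤ a) :
    H.IsTame ν a (2 * tameSlack a K L n) (tameSlack a K L n) (X ∪ Y) := by
  refine isTame_of_eq_union (Z := ∅) (s := {X, Y}) hν hK (by simp) ?_ hδ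
    (by simp [inducedEdges_empty]) (by simp [hX, hY]) ?_
  · simpa [Set.pairwiseDisjoint_insert] using fun _ => hd
  · exact (Finset.card_filter_le _ _).trans (Finset.card_le_two.trans hn)

end Tame

end Multigraph

namespace Multigraph

section Peeling

variable {H : Multigraph}

theorem not_mem_sym2_left {M : Multigraph} {m : M.E} {x y : M.V} (h : M.ends m = s(x, y)) :
    x ≠ y := by
  rintro rfl
  exact M.loopless m (by rw [h]; exact Sym2.mk_isDiag_iff.2 rfl)

theorem ncard_edgeBoundary_union_le {A B : Set H.V} (hd : Disjoint A B) {e : H.E} {u v : H.V}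
    (he : H.ends e = s(u, v)) (hu : u ∈ A) (hv : v ∈ B) :
    (H.edgeBoundary (A ∪ B)).ncard + 2 ≤ (H.edgeBoundary A).ncard + (H.edgeBoundary B).ncard := by
  have hvA : v ∉ A := fun h => hd.le_bot ⟨h, hv⟩
  have huB : u ∉ B := fun h => hd.le_bot ⟨hu, h⟩
  have heA : e ∈ H.edgeBoundary A := ⟨u, v, he, hu, hvA⟩
  have heB : e ∈ H.edgeBoundary B := ⟨v, u, he.trans Sym2.eq_swap, hv, huB⟩
  have heAB : e ∉ H.edgeBoundary (A ∪ B) := by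
    rintro ⟨x, y, hxy, -, hy⟩
    rw [he, Sym2.eq_iff] at hxy
    rcases hxy with ⟨-, rfl⟩ | ⟨rfl, -⟩
    exacts [hy (.inr hv), hy (.inl hu)]
  have hsub : H.edgeBoundary (A ∪ B) ⊆
      (H.edgeBoundary A \ {e}) ∪ (H.edgeBoundary B \ {e}) := by
    intro f hf
    have hfe : f ≠ e := fun h => heAB (h ▸ hf)
    exact (edgeBoundary_union_subset A B hf).imp (fun h => ⟨h, hfe⟩) (fun h => ⟨h, hfe⟩)
  have h1 := (Set.ncard_le_ncard hsub).trans (Set.ncard_union_le _ _)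
  have h2 := Set.ncard_sdiff_singleton_add_one heA
  have h3 := Set.ncard_sdiff_singleton_add_one heB
  omega

/-- A marked graph obtained from `H` by consolidating vertex sets, together with a collection of
sets of small boundary that were removed. -/
structure Peeling {H : Multigraph} (Z V' : Set H.V) (Q : Set H.V → Prop) (M : MarkedGraph) where
  proj : H.V → Option M.G.V
  edge : M.G.E → H.E
  thin : Finset (Set H.V)
  exists_core : ∀ v ∈ Z, ∃ x ∈ M.core, proj v = some x
  mem_of_core : ∀ v, ∀ x ∈ M.core, proj v = some x → v ∈ Z
  injOn : Set.InjOn proj Z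
  lift : ∀ x ∉ M.core, ∀ e u v, H.ends e = s(u, v) → proj u = some x → proj v ≠ some x →
    ∃ m y, edge m = e ∧ proj v = some y ∧ M.G.ends m = s(x, y)
  edge_ends : ∀ m x y, M.G.ends m = s(x, y) → x ∉ M.core →
    ∃ u v, H.ends (edge m) = s(u, v) ∧ proj u = some x ∧ proj v = some y
  part : ∀ x ∉ M.core, Q {u | proj u = some x}
  thin_spec : ∀ S ∈ thin, Q S ∧ (H.edgeBoundary S).ncard ≤ 2 ∧ H.nbhd S ⊆ Z
  thin_disjoint : (thin : Set (Set H.V)).PairwiseDisjoint id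
  proj_thin : ∀ S ∈ thin, ∀ u ∈ S, proj u = none
  exists_thin : ∀ u ∈ V', proj u = none → ∃ S ∈ thin, u ∈ S

/-- Remove the vertex `z` of a marked graph and replace the edges. -/
def _root_.MarkedGraph.avoid (M : MarkedGraph) (z : M.G.V) (E' : Type) [Fintype E']
    (ends' : E' → Sym2 M.G.V) (hz : ∀ e, ∀ v ∈ ends' e, v ≠ z)
    (hl : ∀ e, ¬ (ends' e).IsDiag) : MarkedGraph where
  G :=
    { V := {v : M.G.V // v ≠ z}
      E := E'
      fintypeV := inferInstance
      fintypeE := inferInstance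
      ends := fun e => (ends' e).attachWith (hz e)
      loopless := fun e h => hl e (by
        have := Sym2.attachWith_map_subtypeVal (hz e)
        rw [← this]
        generalize (ends' e).attachWith (hz e) = q at h
        induction q using Sym2.ind with
        | _ x y =>
          rw [Sym2.mk_isDiag_iff] at h
          rw [h, Sym2.map_mk, Sym2.mk_isDiag_iff]) }
  core := {w | w.1 ∈ M.core}

section Avoid

variable {M : MarkedGraph} {z : M.G.V} {E' : Type} [Fintype E'] {ends' : E' → Sym2 M.G.V}
  {hz : ∀ e, ∀ v ∈ ends' e, v ≠ z} {hl : ∀ e, ¬ (ends' e).IsDiag}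

theorem map_ends_avoid (e : E') :
    ((M.avoid z E' ends' hz hl).G.ends e).map Subtype.val = ends' e :=
  Sym2.attachWith_map_subtypeVal (hz e)

theorem ends_avoid_eq_iff (e : E') (x y : {v : M.G.V // v ≠ z}) :
    (M.avoid z E' ends' hz hl).G.ends e = s(x, y) ↔ ends' e = s(x.1, y.1) := by
  rw [← map_ends_avoid (hz := hz) (hl := hl) e]
  constructor
  · intro h; rw [h]; rfl
  · intro h
    exact Sym2.map.injective Subtype.val_injective h

theorem card_avoid_lt : Fintype.card (M.avoid z E' ends' hz hl).G.V < Fintype.card M.G.V :=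
  Fintype.card_subtype_lt (p := fun v => v ≠ z) (x := z) (by simp)

end Avoid

namespace Peeling

variable {Z V' : Set H.V} {Q : Set H.V → Prop} {M : MarkedGraph}

theorem ncard_edgeBoundary_le (P : Peeling Z V' Q M) {x : M.G.V} (hx : x ∉ M.core) :
    (H.edgeBoundary {u | P.proj u = some x}).ncard ≤ M.G.degree x := by
  have : H.edgeBoundary {u | P.proj u = some x} ⊆ P.edge '' {m | x ∈ M.G.ends m} := by
    rintro e ⟨u, v, he, hu, hv⟩
    obtain ⟨m, y, hm, -, hends⟩ := P.lift x hx e u v he hu hv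
    exact ⟨m, by simp [hends], hm⟩
  exact (Set.ncard_le_ncard this).trans (Set.ncard_image_le (Set.toFinite _))

/-- Redirect the vertices projected to `z` to `r`. -/
def redirectProj (P : Peeling Z V' Q M) (z : M.G.V) (r : Option {v : M.G.V // v ≠ z}) (u : H.V) :
    Option {v : M.G.V // v ≠ z} :=
  (P.proj u).bind fun x => if h : x = z then r else some ⟨x, h⟩

section

variable {P : Peeling Z V' Q M} {z : M.G.V} {r : Option {v : M.G.V // v ≠ z}} {u : H.V}

theorem redirectProj_eq_some {x : {v : M.G.V // v ≠ z}} :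
    P.redirectProj z r u = some x ↔
      P.proj u = some x.1 ∨ P.proj u = some z ∧ r = some x := by
  unfold redirectProj
  cases h : P.proj u with
  | none => simp
  | some y =>
    by_cases hy : y = z
    · have := x.2
      simp [hy, this.symm]
    · simp [hy, Subtype.ext_iff]

theorem redirectProj_eq_none :
    P.redirectProj z r u = none ↔ P.proj u = none ∨ P.proj u = some z ∧ r = none := by
  unfold redirectProj
  cases h : P.proj u with
  | none => simp
  | some y => by_cases hy : y = z <;> simp [hy]

end

/-- Remove a peripheral vertex `z`, merging its part into the part of `r`, or, if `r = none`,
removing its part. -/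
def redirect (P : Peeling Z V' Q M) {z : M.G.V} (hzc : z ∉ M.core)
    {E' : Type} [Fintype E'] {ends' : E' → Sym2 M.G.V}
    (hz : ∀ e, ∀ v ∈ ends' e, v ≠ z) (hl : ∀ e, ¬ (ends' e).IsDiag)
    (edge' : E' → H.E) (r : Option {v : M.G.V // v ≠ z})
    (hsome : ∀ y, r = some y → y.1 ∉ M.core ∧
      Q ({u | P.proj u = some y.1} ∪ {u | P.proj u = some z}))
    (hnone : r = none → (H.edgeBoundary {u | P.proj u = some z}).ncard ≤ 2 ∧
      H.nbhd {u | P.proj u = some z} ⊆ Z)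
    (h1 : ∀ m x y, x ≠ z → y ≠ z → M.G.ends m = s(x, y) →
      ∃ m', ends' m' = s(x, y) ∧ edge' m' = P.edge m)
    (h2 : ∀ m x, x ∉ M.core → M.G.ends m = s(x, z) → (∀ hx : x ≠ z, r ≠ some ⟨x, hx⟩) →
      ∃ y, r = some y ∧ ∃ m', ends' m' = s(x, y.1) ∧ edge' m' = P.edge m)
    (h3 : ∀ m w y, r = some y → w ≠ y.1 → M.G.ends m = s(z, w) →
      ∃ m', ends' m' = s(y.1, w) ∧ edge' m' = P.edge m)
    (h4 : ∀ m' x y, ends' m' = s(x, y) → x ∉ M.core →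
      (∃ m, M.G.ends m = s(x, y) ∧ edge' m' = P.edge m) ∨
      (∃ hx : x ≠ z, r = some ⟨x, hx⟩ ∧ ∃ m, M.G.ends m = s(z, y) ∧ edge' m' = P.edge m) ∨
      (∃ hy : y ≠ z, r = some ⟨y, hy⟩ ∧ ∃ m, M.G.ends m = s(x, z) ∧ edge' m' = P.edge m)) :
    Peeling Z V' Q (M.avoid z E' ends' hz hl) where
  proj := P.redirectProj z r
  edge := edge'
  thin := if r = none then insert {u | P.proj u = some z} P.thin else P.thin
  exists_core := by
    intro v hv
    obtain ⟨x, hx, hpx⟩ := P.exists_core v hv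
    exact ⟨⟨x, fun h => hzc (h ▸ hx)⟩, hx, redirectProj_eq_some.2 (.inl hpx)⟩
  mem_of_core := by
    intro v x hx hp
    rcases redirectProj_eq_some.1 hp with h | ⟨-, h⟩
    · exact P.mem_of_core v _ hx h
    · exact absurd hx (hsome x h).1
  injOn := by
    intro u hu v hv h
    obtain ⟨x, hx, hpx⟩ := P.exists_core u hu
    obtain ⟨y, hy, hpy⟩ := P.exists_core v hv
    have hxz : x ≠ z := fun h => hzc (h ▸ hx)
    have e1 : P.redirectProj z r u = some ⟨x, hxz⟩ := redirectProj_eq_some.2 (.inl hpx)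
    rw [h, redirectProj_eq_some, hpy] at e1
    rcases e1 with e1 | ⟨e1, -⟩
    · exact P.injOn hu hv (by rw [hpx, hpy, e1])
    · exact absurd hy (Option.some_injective _ e1 ▸ hzc)
  lift := by
    intro x hx e u v he hu hv
    have hv' := fun h => hv (redirectProj_eq_some.2 h)
    rcases redirectProj_eq_some.1 hu with hu | ⟨hu, hr⟩
    · obtain ⟨m, w, hm, hw, hmw⟩ := P.lift x.1 hx e u v he hu (fun h => hv' (.inl h))
      by_cases hwz : w = z
      · subst hwz
        obtain ⟨y, hy, m', hm', he'⟩ := h2 m x.1 hx hmw (fun hx h => hv' (.inr ⟨hw, h⟩))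
        exact ⟨m', y, he'.trans hm, redirectProj_eq_some.2 (.inr ⟨hw, hy⟩),
          (ends_avoid_eq_iff _ _ _).2 hm'⟩
      · obtain ⟨m', hm', he'⟩ := h1 m x.1 w x.2 hwz hmw
        exact ⟨m', ⟨w, hwz⟩, he'.trans hm, redirectProj_eq_some.2 (.inl hw),
          (ends_avoid_eq_iff _ _ _).2 hm'⟩
    · obtain ⟨m, w, hm, hw, hmw⟩ := P.lift z hzc e u v he hu (fun h => hv' (.inr ⟨h, hr⟩))
      obtain ⟨m', hm', he'⟩ := h3 m w x hr (fun h => hv' (.inl (h ▸ hw))) hmw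
      have hwz : w ≠ z := (not_mem_sym2_left hmw).symm
      exact ⟨m', ⟨w, hwz⟩, he'.trans hm, redirectProj_eq_some.2 (.inl hw),
        (ends_avoid_eq_iff _ _ _).2 hm'⟩
  edge_ends := by
    intro m' x y hm' hx
    have hm' := (ends_avoid_eq_iff _ _ _).1 hm'
    change ∃ u v, H.ends (edge' m') = s(u, v) ∧ _
    rcases h4 m' x.1 y.1 hm' hx with ⟨m, hm, he⟩ | ⟨hxz, hr, m, hm, he⟩ | ⟨hyz, hr, m, hm, he⟩
    · obtain ⟨u, v, huv, hu, hv⟩ := P.edge_ends m _ _ hm hx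
      exact ⟨u, v, he ▸ huv, redirectProj_eq_some.2 (.inl hu), redirectProj_eq_some.2 (.inl hv)⟩
    · obtain ⟨u, v, huv, hu, hv⟩ := P.edge_ends m _ _ hm hzc
      exact ⟨u, v, he ▸ huv, redirectProj_eq_some.2 (.inr ⟨hu, hr⟩),
        redirectProj_eq_some.2 (.inl hv)⟩
    · obtain ⟨u, v, huv, hu, hv⟩ := P.edge_ends m _ _ hm hx
      exact ⟨u, v, he ▸ huv, redirectProj_eq_some.2 (.inl hu),
        redirectProj_eq_some.2 (.inr ⟨hv, hr⟩)⟩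
  part := by
    intro x hx
    by_cases hr : r = some x
    · convert (hsome x hr).2 using 1
      ext u
      exact redirectProj_eq_some.trans (or_congr_right (and_iff_left hr))
    · convert P.part x.1 hx using 1
      ext u
      exact redirectProj_eq_some.trans (or_iff_left fun h => hr h.2)
  thin_spec := by
    intro S hS
    split_ifs at hS with hr
    · rcases Finset.mem_insert.1 hS with rfl | hS
      · exact ⟨P.part z hzc, hnone hr⟩
      · exact P.thin_spec S hS
    · exact P.thin_spec S hS
  thin_disjoint := by
    split_ifs with hr
    · rw [Finset.coe_insert]
      refine P.thin_disjoint.insert fun S hS _ => ?_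
      refine Set.disjoint_left.2 fun u hu huS => ?_
      have := P.proj_thin S hS u huS
      rw [show P.proj u = some z from hu] at this
      cases this
    · exact P.thin_disjoint
  proj_thin := by
    intro S hS u hu
    refine redirectProj_eq_none.2 ?_
    split_ifs at hS with hr
    · rcases Finset.mem_insert.1 hS with rfl | hS
      · exact .inr ⟨hu, hr⟩
      · exact .inl (P.proj_thin S hS u hu)
    · exact .inl (P.proj_thin S hS u hu)
  exists_thin := by
    intro u huV hu
    rcases redirectProj_eq_none.1 hu with hu | ⟨hu, hr⟩
    · obtain ⟨S, hS, huS⟩ := P.exists_thin u huV hu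
      refine ⟨S, ?_, huS⟩
      split_ifs
      exacts [Finset.mem_insert_of_mem hS, hS]
    · exact ⟨_, by rw [if_pos hr]; exact Finset.mem_insert_self _ _, hu⟩

theorem disjoint_parts (P : Peeling Z V' Q M) {x y : M.G.V} (h : x ≠ y) :
    Disjoint {u | P.proj u = some x} {u | P.proj u = some y} :=
  Set.disjoint_left.2 fun _ (hu : _ = _) (hv : _ = _) =>
    h (Option.some_injective _ (hu.symm.trans hv))

theorem part_union (P : Peeling Z V' Q M) {a : ℕ} (ha : ∀ A, Q A → (H.edgeBoundary A).ncard ≤ a)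
    (hQ : ∀ A B, Disjoint A B → Q A → Q B → (H.edgeBoundary (A ∪ B)).ncard ≤ a → Q (A ∪ B))
    {y z : M.G.V} (hy : y ∉ M.core) (hz : z ∉ M.core) (hd : M.G.degree z ≤ 2) {m : M.G.E}
    (hm : M.G.ends m = s(y, z)) : Q ({u | P.proj u = some y} ∪ {u | P.proj u = some z}) := by
  have hdis := P.disjoint_parts (not_mem_sym2_left hm)
  refine hQ _ _ hdis (P.part y hy) (P.part z hz) ?_
  obtain ⟨u, v, he, hu, hv⟩ := P.edge_ends m y z hm hy
  have h1 := ncard_edgeBoundary_union_le hdis he hu hv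
  have h2 := P.ncard_edgeBoundary_le hz
  have h3 := ha _ (P.part y hy)
  omega

theorem nbhd_part_subset (P : Peeling Z V' Q M) {z : M.G.V} (hz : z ∉ M.core)
    (hn : ∀ m y, M.G.ends m = s(z, y) → y ∈ M.core) : H.nbhd {u | P.proj u = some z} ⊆ Z := by
  rintro v ⟨hv, e, u, hu, he⟩
  obtain ⟨m, y, -, hy, hm⟩ := P.lift z hz e u v (he.trans Sym2.eq_swap) hu hv
  exact P.mem_of_core v y (hn m y hm) hy

theorem exists_suppresses_of_suppPair (P : Peeling Z V' Q M) {a : ℕ}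
    (ha : ∀ A, Q A → (H.edgeBoundary A).ncard ≤ a)
    (hQ : ∀ A B, Disjoint A B → Q A → Q B → (H.edgeBoundary (A ∪ B)).ncard ≤ a → Q (A ∪ B))
    {z : M.G.V} (hz : z ∉ M.core) (hd : M.G.degree z ≤ 2) {x y : M.G.V} (hxy : x ≠ y)
    (hp : SuppPair M.G z x y) (hc : x ∉ M.core ∨ y ∈ M.core) :
    ∃ M', Suppresses M M' ∧ Nonempty (Peeling Z V' Q M') ∧
      Fintype.card M'.G.V < Fintype.card M.G.V := by
  have hp' := hp
  obtain ⟨e1, e2, he, h1, h2, h12⟩ := hp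
  have hzx := not_mem_sym2_left h1
  have hzy := not_mem_sym2_left h2
  set ends' : {e : M.G.E // z ∉ M.G.ends e} ⊕ Unit → Sym2 M.G.V :=
    Sum.elim (fun e' => M.G.ends e'.1) (fun _ => s(x, y)) with hends'
  have hz' : ∀ e, ∀ v ∈ ends' e, v ≠ z := by
    rintro (e | e) v hv rfl
    · exact e.2 hv
    · simp [hends', hzx, hzy] at hv
  have hl : ∀ e, ¬ (ends' e).IsDiag := by
    rintro (e | e) hv
    · exact M.G.loopless _ hv
    · exact hxy (Sym2.mk_isDiag_iff.1 hv)
  refine ⟨M.avoid z _ ends' hz' hl, ⟨z, hz, hd, Equiv.refl _, fun w => Iff.rfl, .inr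
    ⟨x, y, hxy, hp', Equiv.refl _, fun e => map_ends_avoid e⟩⟩, ⟨?_⟩, card_avoid_lt⟩
  have hcase : ∀ m w, M.G.ends m = s(z, w) → (m = e1 ∧ w = x) ∨ (m = e2 ∧ w = y) := by
    intro m w hm
    rcases h12 m (by simp [hm]) with rfl | rfl
    · left; rw [h1, Sym2.congr_right] at hm; exact ⟨rfl, hm.symm⟩
    · right; rw [h2, Sym2.congr_right] at hm; exact ⟨rfl, hm.symm⟩
  refine P.redirect hz hz' hl (Sum.elim (fun e => P.edge e.1) fun _ => P.edge e2)
    (if x ∈ M.core then none else some ⟨x, hzx.symm⟩) ?_ ?_ ?_ ?_ ?_ ?_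
  · intro w hw
    split_ifs at hw with hx
    cases hw
    exact ⟨hx, P.part_union ha hQ hx hz hd (h1.trans Sym2.eq_swap)⟩
  · intro hr
    have hx : x ∈ M.core := by
      by_contra hx
      rw [if_neg hx] at hr
      cases hr
    refine ⟨(P.ncard_edgeBoundary_le hz).trans hd, P.nbhd_part_subset hz fun m w hm => ?_⟩
    rcases hcase m w hm with ⟨-, rfl⟩ | ⟨-, rfl⟩
    · exact hx
    · tauto
  · intro m v w hv hw hm
    exact ⟨.inl ⟨m, by simp [hm, hv.symm, hw.symm]⟩, hm, rfl⟩
  · intro m v hv hm hr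
    rcases hcase m v (hm.trans Sym2.eq_swap) with ⟨rfl, rfl⟩ | ⟨rfl, rfl⟩
    · exact absurd (if_neg hv) (hr hzx.symm)
    · have hx : x ∉ M.core := by tauto
      exact ⟨⟨x, hzx.symm⟩, if_neg hx, .inr (), Sym2.eq_swap, rfl⟩
  · intro m w v hv hw hm
    split_ifs at hv with hx
    cases hv
    rcases hcase m w hm with ⟨rfl, rfl⟩ | ⟨rfl, rfl⟩
    · exact absurd rfl hw
    · exact ⟨.inr (), rfl, rfl⟩
  · rintro (m | m) v w hm hv
    · exact .inl ⟨m.1, hm, rfl⟩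
    · right
      have hx : x ∉ M.core := by
        rcases Sym2.eq_iff.1 (show s(x, y) = s(v, w) from hm) with ⟨rfl, rfl⟩ | ⟨rfl, rfl⟩
        · exact hv
        · tauto
      rcases Sym2.eq_iff.1 (show s(x, y) = s(v, w) from hm) with ⟨rfl, rfl⟩ | ⟨rfl, rfl⟩
      · exact .inl ⟨hzx.symm, if_neg hx, e2, h2, rfl⟩
      · exact .inr ⟨hzx.symm, if_neg hx, e2, h2.trans Sym2.eq_swap, rfl⟩

theorem exists_suppresses_of_not_suppPair (P : Peeling Z V' Q M) {a : ℕ}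
    (ha : ∀ A, Q A → (H.edgeBoundary A).ncard ≤ a)
    (hQ : ∀ A B, Disjoint A B → Q A → Q B → (H.edgeBoundary (A ∪ B)).ncard ≤ a → Q (A ∪ B))
    {z : M.G.V} (hz : z ∉ M.core) (hd : M.G.degree z ≤ 2)
    (hp : ¬ ∃ x y : M.G.V, x ≠ y ∧ SuppPair M.G z x y) :
    ∃ M', Suppresses M M' ∧ Nonempty (Peeling Z V' Q M') ∧
      Fintype.card M'.G.V < Fintype.card M.G.V := by
  have huniq : ∀ m w m' w', M.G.ends m = s(z, w) → M.G.ends m' = s(z, w') → w = w' := by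
    intro m w m' w' hm hm'
    by_contra hww
    refine hp ⟨w, w', hww, m, m', ?_, hm, hm', fun e he => ?_⟩
    · rintro rfl
      exact hww (Sym2.congr_right.1 (hm.symm.trans hm'))
    · have hmm : m ≠ m' := by
        rintro rfl
        exact hww (Sym2.congr_right.1 (hm.symm.trans hm'))
      have hsub : ({m, m'} : Set M.G.E) ⊆ {e | z ∈ M.G.ends e} := by
        rintro f (rfl | rfl)
        · simp [hm]
        · simp [hm']
      have : ({m, m'} : Set M.G.E) = {e | z ∈ M.G.ends e} :=
        Set.eq_of_subset_of_ncard_le hsub (by rw [Set.ncard_pair hmm]; exact hd)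
      have : e ∈ ({m, m'} : Set M.G.E) := this ▸ he
      simpa using this
  have hz' : ∀ e : {e : M.G.E // z ∉ M.G.ends e}, ∀ v ∈ M.G.ends e.1, v ≠ z := by
    rintro e v hv rfl
    exact e.2 hv
  refine ⟨M.avoid z _ (fun e : {e : M.G.E // z ∉ M.G.ends e} => M.G.ends e.1) hz'
    (fun e => M.G.loopless _), ⟨z, hz, hd, Equiv.refl _, fun w => Iff.rfl, .inl
    ⟨hp, Equiv.refl _, fun e => map_ends_avoid e⟩⟩, ⟨?_⟩, card_avoid_lt⟩
  by_cases hn : ∀ m y, M.G.ends m = s(z, y) → y ∈ M.core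
  · refine P.redirect hz hz' (fun e => M.G.loopless _) (fun e => P.edge e.1) none ?_ ?_ ?_ ?_ ?_ ?_
    · intro y hy
      cases hy
    · intro _
      exact ⟨(P.ncard_edgeBoundary_le hz).trans hd, P.nbhd_part_subset hz hn⟩
    · intro m v w hv hw hm
      exact ⟨⟨m, by simp [hm, hv.symm, hw.symm]⟩, hm, rfl⟩
    · intro m v hv hm _
      exact absurd (hn m v (hm.trans Sym2.eq_swap)) hv
    · intro m w y hy
      cases hy
    · intro m v w hm hv
      exact .inl ⟨m.1, hm, rfl⟩
  · push Not at hn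
    choose m₀ y hm₀ hy using hn
    have hyz := (not_mem_sym2_left hm₀).symm
    refine P.redirect hz hz' (fun e => M.G.loopless _) (fun e => P.edge e.1) (some ⟨y, hyz⟩)
      ?_ ?_ ?_ ?_ ?_ ?_
    · intro w hw
      cases hw
      exact ⟨hy, P.part_union ha hQ hy hz hd (hm₀.trans Sym2.eq_swap)⟩
    · intro h
      cases h
    · intro m v w hv hw hm
      exact ⟨⟨m, by simp [hm, hv.symm, hw.symm]⟩, hm, rfl⟩
    · intro m v hv hm hr
      have := huniq _ _ _ _ (hm.trans Sym2.eq_swap) hm₀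
      subst this
      exact absurd rfl (hr hyz)
    · intro m w v hv hw hm
      cases hv
      exact absurd (huniq _ _ _ _ hm hm₀) hw
    · intro m v w hm hv
      exact .inl ⟨m.1, hm, rfl⟩

theorem exists_suppresses (P : Peeling Z V' Q M) {a : ℕ}
    (ha : ∀ A, Q A → (H.edgeBoundary A).ncard ≤ a)
    (hQ : ∀ A B, Disjoint A B → Q A → Q B → (H.edgeBoundary (A ∪ B)).ncard ≤ a → Q (A ∪ B))
    {z : M.G.V} (hz : z ∉ M.core) (hd : M.G.degree z ≤ 2) :
    ∃ M', Suppresses M M' ∧ Nonempty (Peeling Z V' Q M') ∧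
      Fintype.card M'.G.V < Fintype.card M.G.V := by
  by_cases hp : ∃ x y : M.G.V, x ≠ y ∧ SuppPair M.G z x y
  · obtain ⟨x, y, hxy, hp⟩ := hp
    by_cases hc : x ∉ M.core ∨ y ∈ M.core
    · exact P.exists_suppresses_of_suppPair ha hQ hz hd hxy hp hc
    · have hp' : SuppPair M.G z y x := by
        obtain ⟨e1, e2, he, h1, h2, h⟩ := hp
        exact ⟨e2, e1, he.symm, h2, h1, fun e he => (h e he).symm⟩
      exact P.exists_suppresses_of_suppPair ha hQ hz hd hxy.symm hp' (by tauto)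
  · exact P.exists_suppresses_of_not_suppPair ha hQ hz hd hp

theorem exists_terminal {a : ℕ} (ha : ∀ A, Q A → (H.edgeBoundary A).ncard ≤ a)
    (hQ : ∀ A B, Disjoint A B → Q A → Q B → (H.edgeBoundary (A ∪ B)).ncard ≤ a → Q (A ∪ B))
    (n : ℕ) : ∀ M : MarkedGraph, Peeling Z V' Q M → Fintype.card M.G.V = n →
    ∃ M', Relation.ReflTransGen Suppresses M M' ∧ M'.Terminal ∧ Nonempty (Peeling Z V' Q M') := by
  induction n using Nat.strong_induction_on with
  | _ n ih =>
    intro M P hn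
    by_cases ht : M.Terminal
    · exact ⟨M, .refl, ht, ⟨P⟩⟩
    · simp only [MarkedGraph.Terminal, not_forall, not_lt] at ht
      obtain ⟨z, hz, hd⟩ := ht
      obtain ⟨M', hM', ⟨P'⟩, hlt⟩ := P.exists_suppresses ha hQ hz hd
      obtain ⟨M'', h1, h2⟩ := ih _ (hn ▸ hlt) M' P' rfl
      exact ⟨M'', .head hM' h1, h2⟩

end Peeling
end Peeling
end Multigraph

section Tree

variable {N : Type} {T : SimpleGraph N}

theorem SimpleGraph.IsAcyclic.not_reachable_deleteEdges (hT : T.IsAcyclic) {a b : N}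
    (h : T.Adj a b) : ¬ (T.deleteEdges {s(a, b)}).Reachable a b :=
  SimpleGraph.isBridge_iff.1 (SimpleGraph.isAcyclic_iff_forall_adj_isBridge.1 hT h)

theorem SimpleGraph.Reachable.or_of_deleteEdges {a b s : N} (hs : T.Reachable s a) :
    (T.deleteEdges {s(a, b)}).Reachable s a ∨ (T.deleteEdges {s(a, b)}).Reachable s b := by
  obtain ⟨p⟩ := hs
  induction p with
  | nil => exact .inl .rfl
  | @cons x y w hxy p ih =>
    by_cases he : s(x, y) = s(w, b)
    · rcases Sym2.eq_iff.1 he with ⟨rfl, rfl⟩ | ⟨rfl, rfl⟩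
      · exact .inl .rfl
      · exact .inr .rfl
    · have : (T.deleteEdges {s(w, b)}).Reachable x y :=
        SimpleGraph.Adj.reachable (by simp [hxy, he])
      exact ih.imp this.trans this.trans

theorem SimpleGraph.IsAcyclic.reachable_deleteEdges_iff (hT : T.IsAcyclic) {t c s : N}
    (h : T.Adj t c) : (T.deleteEdges {e : Sym2 N | t ∈ e}).Reachable s c ↔
      (T.deleteEdges {s(c, t)}).Reachable s c := by
  constructor
  · exact SimpleGraph.Reachable.mono (SimpleGraph.deleteEdges_anti (by simp))
  · rintro ⟨p⟩
    have hb := hT.not_reachable_deleteEdges h.symm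
    generalize hT' : T.deleteEdges {s(c, t)} = T' at p hb
    induction p with
    | nil => exact .rfl
    | @cons x y w hxy p ih =>
      refine SimpleGraph.Reachable.trans (SimpleGraph.Adj.reachable ?_) (ih h hT' hb)
      subst hT'
      simp only [SimpleGraph.deleteEdges_adj, Set.mem_ofPred_eq, Sym2.mem_iff, not_or] at hxy ⊢
      refine ⟨hxy.1, ?_, ?_⟩
      · rintro rfl
        exact hb (SimpleGraph.Reachable.symm ⟨.cons (by simpa using hxy) p⟩)
      · rintro rfl
        exact hb (SimpleGraph.Reachable.symm ⟨p⟩)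

theorem SimpleGraph.IsAcyclic.eq_of_reachable_deleteEdges (hT : T.IsAcyclic) {t c c' s : N}
    (h : T.Adj t c) (h' : T.Adj t c')
    (hs : (T.deleteEdges {e : Sym2 N | t ∈ e}).Reachable s c)
    (hs' : (T.deleteEdges {e : Sym2 N | t ∈ e}).Reachable s c') : c = c' := by
  by_contra hne
  refine hT.not_reachable_deleteEdges h.symm (((hs.symm.trans hs').mono
    (SimpleGraph.deleteEdges_anti (by simp))).trans (SimpleGraph.Adj.reachable ?_))
  have := h.ne
  simp [h'.symm, Ne.symm hne]
  tauto

theorem SimpleGraph.Reachable.exists_adj {s t : N} (hs : T.Reachable s t) (hne : s ≠ t) :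
    ∃ c, T.Adj t c ∧ (T.deleteEdges {e : Sym2 N | t ∈ e}).Reachable s c := by
  obtain ⟨p⟩ := hs
  induction p with
  | nil => exact absurd rfl hne
  | @cons x y w hxy p ih =>
    by_cases hy : y = w
    · subst hy
      exact ⟨x, hxy.symm, .rfl⟩
    · obtain ⟨c, hc, hr⟩ := ih hy
      refine ⟨c, hc, SimpleGraph.Reachable.trans (SimpleGraph.Adj.reachable ?_) hr⟩
      simp [hxy, Ne.symm hne, Ne.symm hy]

end Tree

namespace TreeCutDecomp

variable {G : Multigraph} (D : TreeCutDecomp G)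

/-- The vertices in the bags of the tree of `t`. -/
def treeSet (t : D.N) : Set G.V := {v | D.T.Reachable (D.nodeOf v) t}

variable {D}

theorem mem_bag_iff {v : G.V} {t : D.N} : v ∈ D.bag t ↔ D.nodeOf v = t := by
  constructor
  · intro h
    by_contra hne
    exact Finset.disjoint_left.1 (D.bag_disjoint _ _ hne) (D.mem_bag v) h
  · rintro rfl
    exact D.mem_bag v

theorem mem_treeSet_of_ends {e : G.E} {u v : G.V} (he : G.ends e = s(u, v)) {t : D.N}
    (hu : u ∈ D.treeSet t) : v ∈ D.treeSet t :=
  ((D.comp_compat u v).1 ⟨.cons e he (.nil v)⟩).symm.trans hu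

theorem edgeBoundary_treeSet (t : D.N) : G.edgeBoundary (D.treeSet t) = ∅ := by
  ext e
  simp only [Set.mem_empty_iff_false, iff_false]
  rintro ⟨u, v, he, hu, hv⟩
  exact hv (mem_treeSet_of_ends he hu)

theorem bag_subset_treeSet (t : D.N) : (D.bag t : Set G.V) ⊆ D.treeSet t := by
  intro v hv
  have : D.nodeOf v = t := mem_bag_iff.1 hv
  exact this ▸ SimpleGraph.Reachable.rfl

theorem treeSet_eq_of_adj {s t : D.N} (h : D.T.Adj s t) : D.treeSet s = D.treeSet t := by
  ext v
  exact ⟨fun hv => hv.trans h.reachable, fun hv => hv.trans h.reachable.symm⟩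

theorem side_subset_treeSet (s t : D.N) : D.side s t ⊆ D.treeSet s := by
  intro v hv
  exact SimpleGraph.Reachable.mono (SimpleGraph.deleteEdges_le _) hv

theorem side_eq_sdiff {s t : D.N} (h : D.T.Adj s t) : D.side t s = D.treeSet s \ D.side s t := by
  ext v
  have hsw : (s(t, s) : Sym2 D.N) = s(s, t) := Sym2.eq_swap
  constructor
  · intro hv
    refine ⟨treeSet_eq_of_adj h ▸ side_subset_treeSet _ _ hv, fun hv' => ?_⟩
    have hv : (D.T.deleteEdges {s(t, s)}).Reachable (D.nodeOf v) t := hv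
    rw [hsw] at hv
    exact D.acyclic.not_reachable_deleteEdges h (SimpleGraph.Reachable.trans hv'.symm hv)
  · rintro ⟨hv, hv'⟩
    change (D.T.deleteEdges {s(t, s)}).Reachable (D.nodeOf v) t
    rw [hsw]
    exact (SimpleGraph.Reachable.or_of_deleteEdges hv).resolve_left hv'

theorem edgeBoundary_side_subset {s t : D.N} (h : D.T.Adj s t) :
    G.edgeBoundary (D.side s t) ⊆ D.adh s t := by
  rintro e ⟨u, v, he, hu, hv⟩
  refine ⟨u, v, he, hu, ?_⟩
  rw [side_eq_sdiff h]
  exact ⟨mem_treeSet_of_ends he (side_subset_treeSet _ _ hu), hv⟩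

theorem ncard_edgeBoundary_side_le {s t : D.N} (h : D.T.Adj s t) :
    (G.edgeBoundary (D.side s t)).ncard ≤ D.width := by
  refine (Set.ncard_le_ncard (edgeBoundary_side_subset h)).trans
    (le_trans ?_ (le_max_left _ _))
  have := Finset.le_sup (f := fun pq : D.N × D.N =>
    if D.T.Adj pq.1 pq.2 then (D.adh pq.1 pq.2).ncard else 0) (Finset.mem_univ (s, t))
  simp only [if_pos h] at this
  exact this

theorem torsoProj_eq_inl {t : D.N} {v : G.V} {w : {v : G.V // v ∈ D.bag t}} :
    D.torsoProj t v = some (Sum.inl w) ↔ v = w.1 := by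
  unfold torsoProj
  constructor
  · intro h
    split_ifs at h with h1
    · cases h
      rfl
    · cases h
  · rintro rfl
    exact dif_pos w.2

theorem torsoProj_eq_inr {t : D.N} {v : G.V} {x : {x : D.N // D.T.Adj t x}} :
    D.torsoProj t v = some (Sum.inr x) ↔ v ∈ D.side x.1 t := by
  unfold torsoProj
  have key : ∀ x : {x : D.N // D.T.Adj t x}, v ∈ D.side x.1 t ↔
    (D.T.deleteEdges {e : Sym2 D.N | t ∈ e}).Reachable (D.nodeOf v) x.1 :=
      fun x => (D.acyclic.reachable_deleteEdges_iff x.2).symm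
  constructor
  · intro h
    split_ifs at h with h1 h2
    · cases h
    · have := h2.choose_spec
      rw [Sum.inr_injective (Option.some_injective _ h)] at this
      exact (key x).2 this
  · intro h
    have h1 : v ∉ D.bag t := by
      intro hv
      have hv := mem_bag_iff.1 hv
      have h : (D.T.deleteEdges {s(x.1, t)}).Reachable (D.nodeOf v) x.1 := h
      rw [hv] at h
      exact D.acyclic.not_reachable_deleteEdges x.2.symm h.symm
    have h2 : ∃ x : {x : D.N // D.T.Adj t x},
      (D.T.deleteEdges {e : Sym2 D.N | t ∈ e}).Reachable (D.nodeOf v) x.1 := ⟨x, (key x).1 h⟩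
    rw [dif_neg h1, dif_pos h2]
    congr 2
    exact Subtype.ext (D.acyclic.eq_of_reachable_deleteEdges h2.choose.2 x.2 h2.choose_spec
      ((key x).1 h))

theorem exists_torsoProj {t : D.N} {v : G.V} (hv : v ∈ D.treeSet t) :
    ∃ y, D.torsoProj t v = some y := by
  by_cases h : v ∈ D.bag t
  · exact ⟨_, torsoProj_eq_inl (w := ⟨v, h⟩).2 rfl⟩
  · obtain ⟨c, hc, hr⟩ := SimpleGraph.Reachable.exists_adj hv (fun h' => h (mem_bag_iff.2 h'))
    exact ⟨_, torsoProj_eq_inr (x := ⟨c, hc⟩).2 ((D.acyclic.reachable_deleteEdges_iff hc).1 hr)⟩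

theorem torsoGraph_ends_eq {t : D.N} (m : (D.torsoGraph t).E) (x y : D.TorsoV t) :
    (D.torsoGraph t).ends m = s(x, y) ↔
      Sym2.map (D.torsoProj t) (G.ends m.1) = s(some x, some y) := by
  rw [m.2.choose_spec.choose_spec.2]
  change s(m.2.choose, m.2.choose_spec.choose) = s(x, y) ↔ _
  constructor
  · intro h
    exact congrArg (Sym2.map some) h
  · intro h
    exact Sym2.map.injective (Option.some_injective _) h

/-- The trivial peeling of a torso. -/
def peeling (t : D.N) (Q : Set G.V → Prop) (hQ : ∀ x, D.T.Adj x t → Q (D.side x t)) :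
    Peeling (D.bag t : Set G.V) (D.treeSet t) Q (D.torso t) where
  proj := D.torsoProj t
  edge := fun m => m.1
  thin := ∅
  exists_core := fun v hv => ⟨_, ⟨⟨v, hv⟩, rfl⟩, torsoProj_eq_inl.2 rfl⟩
  mem_of_core := by
    rintro v _ ⟨w, rfl⟩ h
    rw [torsoProj_eq_inl.1 h]
    exact w.2
  injOn := by
    intro u hu v hv h
    rw [torsoProj_eq_inl (w := ⟨u, hu⟩) |>.2 rfl] at h
    exact (torsoProj_eq_inl.1 h.symm).symm
  lift := by
    rintro x hx e u v he hu hv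
    rcases x with x | x
    · exact absurd ⟨x, rfl⟩ hx
    have hut : u ∈ D.treeSet t :=
      treeSet_eq_of_adj x.2 ▸ side_subset_treeSet _ _ (torsoProj_eq_inr.1 hu)
    obtain ⟨y, hy⟩ := exists_torsoProj (mem_treeSet_of_ends he hut)
    have hm : Sym2.map (D.torsoProj t) (G.ends e) = s(some (Sum.inr x), some y) := by
      rw [he, Sym2.map_mk, hu, hy]
      rfl
    refine ⟨⟨e, Sum.inr x, y, ?_, hm⟩, y, rfl, hy, (torsoGraph_ends_eq _ _ _).2 hm⟩
    rintro rfl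
    exact hv hy
  edge_ends := by
    intro m x y hm _
    have hm := (torsoGraph_ends_eq _ _ _).1 hm
    obtain ⟨u, v, he⟩ := G.exists_ends m.1
    rw [he, Sym2.map_mk, Sym2.eq_iff] at hm
    rcases hm with ⟨hu, hv⟩ | ⟨hu, hv⟩
    · exact ⟨u, v, he, hu, hv⟩
    · exact ⟨v, u, he.trans Sym2.eq_swap, hv, hu⟩
  part := by
    rintro x hx
    rcases x with x | x
    · exact absurd ⟨x, rfl⟩ hx
    · convert hQ x.1 x.2.symm using 1
      ext v
      exact torsoProj_eq_inr
  thin_spec := by simp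
  thin_disjoint := by simp
  proj_thin := by simp
  exists_thin := by
    intro u hu h
    obtain ⟨y, hy⟩ := exists_torsoProj hu
    rw [hy] at h
    cases h

end TreeCutDecomp

theorem Suppresses.card_le {M M' : MarkedGraph} (h : Suppresses M M') :
    Fintype.card M'.G.V ≤ Fintype.card M.G.V := by
  obtain ⟨z, -, -, f, -⟩ := h
  exact (Fintype.card_congr f).trans_le (Fintype.card_subtype_le _)

namespace TreeCutDecomp

variable {G : Multigraph} {D : TreeCutDecomp G}

/-- Around a node of a tree-cut decomposition, the sides can be merged into few sets and sets of
boundary at most two attached to the bag. -/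
theorem exists_parts {a : ℕ} (hw : D.width ≤ a) (t : D.N) {Q : Set G.V → Prop}
    (ha : ∀ A, Q A → (G.edgeBoundary A).ncard ≤ a)
    (hQ : ∀ A B, Disjoint A B → Q A → Q B → (G.edgeBoundary (A ∪ B)).ncard ≤ a → Q (A ∪ B))
    (hs : ∀ x, D.T.Adj x t → Q (D.side x t)) :
    ∃ B S : Finset (Set G.V), (D.bag t).card ≤ a ∧ B.card ≤ a ∧
      (∀ A ∈ B ∪ S, Q A ∧ Disjoint A (D.bag t)) ∧
      ((B ∪ S : Finset (Set G.V)) : Set (Set G.V)).PairwiseDisjoint id ∧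
      (∀ A ∈ S, (G.edgeBoundary A).ncard ≤ 2 ∧ G.nbhd A ⊆ D.bag t) ∧
      D.treeSet t ⊆ D.bag t ∪ ⋃ A ∈ B ∪ S, A := by
  obtain ⟨M, hM, hMt, ⟨P⟩⟩ := (peeling t Q hs).exists_terminal ha hQ _ _ rfl
  have hcard : Fintype.card M.G.V ≤ a := by
    have hbdd : BddAbove (D.threeCenterSizes t) := by
      refine ⟨Fintype.card (D.torso t).G.V, ?_⟩
      rintro n ⟨M, hM, -, rfl⟩
      induction hM with
      | refl => exact le_rfl
      | tail _ h ih => exact h.card_le.trans ih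
    refine (le_csSup hbdd ⟨M, hM, hMt, rfl⟩).trans (le_trans ?_ hw)
    exact (Finset.le_sup (f := fun t => sSup (D.threeCenterSizes t)) (Finset.mem_univ t)).trans
      (le_max_right _ _)
  have hpart : ∀ x ∉ M.core, Disjoint {u | P.proj u = some x} (D.bag t : Set G.V) := by
    intro x hx
    refine Set.disjoint_left.2 fun u (hu : _ = _) hub => ?_
    obtain ⟨y, hy, hp⟩ := P.exists_core u hub
    rw [hu] at hp
    exact hx (Option.some_injective _ hp ▸ hy)
  refine ⟨(Finset.univ.filter (· ∉ M.core)).image fun x => {u | P.proj u = some x}, P.thin,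
    ?_, ?_, ?_, ?_, fun A hA => (P.thin_spec A hA).2, ?_⟩
  · choose f hf hfp using P.exists_core
    have : Function.Injective fun v : {v // v ∈ D.bag t} => f v.1 v.2 := by
      intro u v huv
      exact Subtype.ext (P.injOn u.2 v.2 ((hfp _ u.2).trans
        ((congrArg some huv).trans (hfp _ v.2).symm)))
    have := Fintype.card_le_of_injective _ this
    rw [Fintype.card_coe] at this
    exact this.trans hcard
  · exact Finset.card_image_le.trans ((Finset.card_filter_le _ _).trans hcard)
  · intro A hA
    rcases Finset.mem_union.1 hA with hA | hA
    · obtain ⟨x, hx, rfl⟩ := Finset.mem_image.1 hA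
      have hx := (Finset.mem_filter.1 hx).2
      exact ⟨P.part x hx, hpart x hx⟩
    · refine ⟨(P.thin_spec A hA).1, Set.disjoint_left.2 fun u hu hub => ?_⟩
      obtain ⟨y, -, hp⟩ := P.exists_core u hub
      rw [P.proj_thin A hA u hu] at hp
      cases hp
  · rw [Finset.coe_union, Set.pairwiseDisjoint_union]
    refine ⟨?_, P.thin_disjoint, ?_⟩
    · intro A hA B hB hAB
      obtain ⟨x, -, rfl⟩ := Finset.mem_image.1 hA
      obtain ⟨y, -, rfl⟩ := Finset.mem_image.1 hB
      exact P.disjoint_parts fun h => hAB (h ▸ rfl)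
    · intro A hA B hB _
      obtain ⟨x, -, rfl⟩ := Finset.mem_image.1 hA
      refine Set.disjoint_left.2 fun u (hu : _ = _) huB => ?_
      rw [P.proj_thin B hB u huB] at hu
      cases hu
  · intro u hu
    cases hp : P.proj u with
    | none =>
      obtain ⟨A, hA, huA⟩ := P.exists_thin u hu hp
      exact .inr (Set.mem_iUnion₂.2 ⟨A, Finset.mem_union_right _ hA, huA⟩)
    | some x =>
      by_cases hx : x ∈ M.core
      · exact .inl (P.mem_of_core u x hx hp)
      · exact .inr (Set.mem_iUnion₂.2 ⟨{u | P.proj u = some x}, Finset.mem_union_left _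
          (Finset.mem_image_of_mem _ (by simp [hx])), hp⟩)

end TreeCutDecomp

theorem SimpleGraph.IsAcyclic.reachable_of_reachable_child {N : Type} {T : SimpleGraph N}
    (hT : T.IsAcyclic) {t b c s : N} (hc : T.Adj c t) (hcb : c ≠ b)
    (hs : (T.deleteEdges {s(c, t)}).Reachable s c) :
    (T.deleteEdges {s(t, b)}).Reachable s t := by
  refine ((hT.reachable_deleteEdges_iff hc.symm).2 hs).mono
    (SimpleGraph.deleteEdges_anti (by simp)) |>.trans (SimpleGraph.Adj.reachable ?_)
  simp [hc, hcb, hc.ne]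

namespace Multigraph

/-- The properties of a charge `ν` needed to bound the number of edges of `H` by the charge. -/
structure IsSparse (H : Multigraph) (ν : Set H.V → ℕ) (a K L q : ℕ) : Prop where
  superadditive : Superadditive ν
  ncard_le_of_eq_zero : ∀ X, ν X = 0 → (H.edgeBoundary X).ncard ≤ 2 * a →
    (H.inducedEdges X).ncard ≤ K
  card_thin_le : ∀ Z : Finset H.V, Z.card ≤ a → ∀ s : Finset (Set H.V),
    (s : Set (Set H.V)).PairwiseDisjoint id →
    (∀ S ∈ s, S.Nonempty ∧ ν S = 0 ∧ (H.edgeBoundary S).ncard ≤ 2 ∧ H.nbhd S ⊆ Z) → s.card ≤ q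
  ncard_le_of_card_le : ∀ Z : Finset H.V, Z.card ≤ a → (H.inducedEdges Z).ncard ≤ L

namespace IsSparse

variable {H : Multigraph} {ν : Set H.V → ℕ} {a K L q : ℕ} {D : TreeCutDecomp H}

/-- Tameness with the constants suitable for a sparse graph. -/
abbrev Tame (_ : H.IsSparse ν a K L q) (X : Set H.V) : Prop :=
  H.IsTame ν a (2 * tameSlack a K L (a + q + 2)) (tameSlack a K L (a + q + 2)) X

theorem tame_union (h : H.IsSparse ν a K L q) {X Y : Set H.V} (hd : Disjoint X Y)
    (hX : h.Tame X) (hY : h.Tame Y) (hδ : (H.edgeBoundary (X ∪ Y)).ncard ≤ a) : h.Tame (X ∪ Y) :=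
  IsTame.union h.superadditive h.ncard_le_of_eq_zero (by omega) hd hX hY hδ

theorem tame_of_sides (h : H.IsSparse ν a K L q) (hw : D.width ≤ a) {t : D.N} {X : Set H.V}
    (hXV : X ⊆ D.treeSet t) (hbX : (D.bag t : Set H.V) ⊆ X)
    (hX : ∀ x, D.T.Adj x t → D.side x t ⊆ X ∧ h.Tame (D.side x t) ∨
      D.side x t = D.treeSet t \ X) : h.Tame X := by
  set V' := D.treeSet t with hV'
  have hV'δ : ∀ S, (H.edgeBoundary S).ncard ≤ a → (H.edgeBoundary (V' \ S)).ncard ≤ a := by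
    intro S hS
    refine (Set.ncard_le_ncard edgeBoundary_diff_subset).trans ?_
    rwa [D.edgeBoundary_treeSet, Set.empty_union]
  set Q : Set H.V → Prop := fun S => (H.edgeBoundary S).ncard ≤ a ∧ S ⊆ V' ∧
    (S ⊆ X ∧ h.Tame S ∨ V' \ X ⊆ S ∧ (V' \ X).Nonempty ∧ (h.Tame (V' \ S) → h.Tame X)) with hQdef
  have key : ∀ A B, Disjoint A B → A ⊆ V' → B ⊆ V' → h.Tame B → (H.edgeBoundary A).ncard ≤ a →
      (h.Tame (V' \ A) → h.Tame X) → h.Tame (V' \ (A ∪ B)) → h.Tame X := by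
    intro A B hd hA hB hBt hAδ hAX hAB
    refine hAX ?_
    have : V' \ A = V' \ (A ∪ B) ∪ B := by
      ext v
      have h1 := @hB v
      have h2 : v ∈ A → v ∉ B := fun ha => Set.disjoint_left.1 hd ha
      simp only [Set.mem_sdiff, Set.mem_union]
      tauto
    have hδ := hV'δ A hAδ
    rw [this] at hδ ⊢
    exact h.tame_union (Set.disjoint_sdiff_left.mono_right Set.subset_union_right) hAB hBt hδ
  have hQu : ∀ A B, Disjoint A B → Q A → Q B → (H.edgeBoundary (A ∪ B)).ncard ≤ a →
      Q (A ∪ B) := by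
    rintro A B hd ⟨hAδ, hA, hA'⟩ ⟨hBδ, hB, hB'⟩ hδ
    refine ⟨hδ, Set.union_subset hA hB, ?_⟩
    rcases hA' with ⟨hAX, hAt⟩ | ⟨hAX, hne, hAt⟩ <;> rcases hB' with ⟨hBX, hBt⟩ | ⟨hBX, hne, hBt⟩
    · exact .inl ⟨Set.union_subset hAX hBX, h.tame_union hd hAt hBt hδ⟩
    · refine .inr ⟨hBX.trans Set.subset_union_right, hne, ?_⟩
      rw [Set.union_comm]
      exact key B A hd.symm hB hA hAt hBδ hBt
    · exact .inr ⟨hAX.trans Set.subset_union_left, hne, key A B hd hA hB hBt hAδ hAt⟩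
    · obtain ⟨v, hv⟩ := hne
      exact absurd (hBX hv) (Set.disjoint_left.1 hd (hAX hv))
  have hQs : ∀ x, D.T.Adj x t → Q (D.side x t) := by
    intro x hx
    have hsub : D.side x t ⊆ V' := hV' ▸ TreeCutDecomp.treeSet_eq_of_adj hx ▸
      TreeCutDecomp.side_subset_treeSet _ _
    refine ⟨(TreeCutDecomp.ncard_edgeBoundary_side_le hx).trans hw, hsub, ?_⟩
    rcases hX x hx with hX | hX
    · exact .inl hX
    · by_cases hne : (V' \ X).Nonempty
      · refine .inr ⟨hX.ge, hne, fun ht => ?_⟩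
        rwa [hX, Set.sdiff_sdiff_cancel_left hXV] at ht
      · left
        have h0 : D.side x t = ∅ := hX.trans (Set.not_nonempty_iff_eq_empty.1 hne)
        rw [h0]
        exact ⟨Set.empty_subset _, by simp [edgeBoundary_empty], .inl h.superadditive.empty⟩
  obtain ⟨B, S, hb, hB, hBS, hdis, hS, hcov⟩ := TreeCutDecomp.exists_parts hw t
    (fun A hA => hA.1) hQu hQs
  have hcount : ∀ s ⊆ B ∪ S, (s.filter fun A => A.Nonempty ∧ ν A = 0).card ≤ a + q + 2 := by
    intro s hs
    have h1 : (s.filter fun A => A.Nonempty ∧ ν A = 0) ⊆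
        B ∪ S.filter (fun A => A.Nonempty ∧ ν A = 0) := by
      intro A hA
      obtain ⟨hA, hA'⟩ := Finset.mem_filter.1 hA
      rcases Finset.mem_union.1 (hs hA) with hA | hA
      · exact Finset.mem_union_left _ hA
      · exact Finset.mem_union_right _ (Finset.mem_filter.2 ⟨hA, hA'⟩)
    have h2 : (S.filter (fun A => A.Nonempty ∧ ν A = 0)).card ≤ q := by
      refine h.card_thin_le (D.bag t) hb _ (hdis.subset ?_) ?_
      · exact Finset.coe_subset.2 ((Finset.filter_subset _ _).trans Finset.subset_union_right)
      · intro A hA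
        obtain ⟨hA, hA'⟩ := Finset.mem_filter.1 hA
        exact ⟨hA'.1, hA'.2, hS A hA⟩
    have := (Finset.card_le_card h1).trans (Finset.card_union_le _ _)
    omega
  by_cases hJ : ∃ J ∈ B ∪ S, V' \ X ⊆ J ∧ (V' \ X).Nonempty ∧ (h.Tame (V' \ J) → h.Tame X)
  · obtain ⟨J, hJs, hXJ, ⟨w, hw⟩, hJt⟩ := hJ
    refine hJt (isTame_of_eq_union (Z := D.bag t) (s := (B ∪ S).erase J) h.superadditive
      h.ncard_le_of_eq_zero ?_ (hdis.subset (by simp)) (hV'δ J (hBS J hJs).1.1)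
      (h.ncard_le_of_card_le _ hb) ?_ (hcount _ (Finset.erase_subset _ _)))
    · refine Set.Subset.antisymm ?_ (Set.union_subset ?_ (Set.iUnion₂_subset ?_))
      · rintro v ⟨hv, hvJ⟩
        rcases hcov hv with hv | hv
        · exact .inl hv
        · obtain ⟨A, hA, hvA⟩ := Set.mem_iUnion₂.1 hv
          exact .inr (Set.mem_iUnion₂.2 ⟨A, Finset.mem_erase.2 ⟨fun h => hvJ (h ▸ hvA), hA⟩, hvA⟩)
      · exact fun v hv => ⟨hXV (hbX hv), fun hvJ => Set.disjoint_left.1 (hBS J hJs).2 hvJ hv⟩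
      · intro A hA v hv
        obtain ⟨hAJ, hA⟩ := Finset.mem_erase.1 hA
        exact ⟨(hBS A hA).1.2.1 hv, fun hvJ => Set.disjoint_left.1 (hdis hA hJs hAJ) hv hvJ⟩
    · intro A hA
      obtain ⟨hAJ, hA⟩ := Finset.mem_erase.1 hA
      obtain ⟨-, -, h1 | ⟨h1, -⟩⟩ := (hBS A hA).1
      · exact h1.2
      · exact absurd (hXJ hw) (Set.disjoint_left.1 (hdis hA hJs hAJ) (h1 hw))
  · have hall : ∀ A ∈ B ∪ S, A ⊆ X ∧ h.Tame A := by
      intro A hA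
      exact (hBS A hA).1.2.2.resolve_right fun h1 => hJ ⟨A, hA, h1⟩
    have hXeq : X = (D.bag t : Set H.V) ∪ ⋃ A ∈ B ∪ S, A :=
      Set.Subset.antisymm (hXV.trans hcov)
        (Set.union_subset hbX (Set.iUnion₂_subset fun A hA => (hall A hA).1))
    have hXV' : X = V' := Set.Subset.antisymm hXV (hcov.trans hXeq.ge)
    refine isTame_of_eq_union h.superadditive h.ncard_le_of_eq_zero hXeq hdis ?_
      (h.ncard_le_of_card_le _ hb) (fun A hA => (hall A hA).2) (hcount _ subset_rfl)
    simp [hXV', hV', D.edgeBoundary_treeSet]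

theorem tame_side (h : H.IsSparse ν a K L q) (hw : D.width ≤ a) (n : ℕ) :
    ∀ t b : D.N, D.T.Adj t b →
      {s | (D.T.deleteEdges {s(t, b)}).Reachable s t}.ncard = n → h.Tame (D.side t b) := by
  induction n using Nat.strong_induction_on with
  | _ n ih =>
    intro t b htb hn
    refine h.tame_of_sides hw (TreeCutDecomp.side_subset_treeSet t b) ?_ ?_
    · intro v hv
      have : D.nodeOf v = t := TreeCutDecomp.mem_bag_iff.1 hv
      exact this ▸ SimpleGraph.Reachable.rfl
    · intro c hc
      by_cases hcb : c = b
      · subst hcb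
        exact .inr (TreeCutDecomp.side_eq_sdiff htb)
      · have hsub := fun s => D.acyclic.reachable_of_reachable_child (s := s) hc hcb
        refine .inl ⟨fun v hv => hsub _ hv, ih _ (hn ▸ Set.ncard_lt_ncard ⟨hsub, ?_⟩) c t hc rfl⟩
        intro hcon
        exact D.acyclic.not_reachable_deleteEdges hc
          (SimpleGraph.Reachable.symm (hcon (SimpleGraph.Reachable.refl t)))

theorem tame_treeSet (h : H.IsSparse ν a K L q) (hw : D.width ≤ a) (t : D.N) :
    h.Tame (D.treeSet t) :=
  h.tame_of_sides hw subset_rfl (TreeCutDecomp.bag_subset_treeSet t) fun x hx =>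
    .inl ⟨TreeCutDecomp.treeSet_eq_of_adj hx ▸ TreeCutDecomp.side_subset_treeSet _ _,
      h.tame_side hw _ x t hx rfl⟩

/-- The number of edges of a sparse graph is linear in the charge. -/
theorem numEdges_le (h : H.IsSparse ν a K L q) (hw : D.width ≤ a)
    (hpos : ∀ t, ν (D.treeSet t) ≠ 0) :
    H.numEdges ≤ 2 * tameSlack a K L (a + q + 2) * ν Set.univ := by
  set C := tameSlack a K L (a + q + 2) with hC
  have hCle : K + a ≤ C := by
    have : C = 2 * (K + 2 * a) + (a + q + 2) * (K + 2 * a) + L := hC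
    omega
  have h1 : ∀ t, (H.inducedEdges (D.treeSet t)).ncard ≤ 2 * C * ν (D.treeSet t) := by
    intro t
    have := (h.tame_treeSet hw t).ncard_inducedEdges_add_le h.superadditive
      h.ncard_le_of_eq_zero (hpos t)
    rw [← hC] at this
    omega
  set s : Finset (Set H.V) := Finset.univ.image fun t => D.treeSet t with hs
  have hsd : (s : Set (Set H.V)).PairwiseDisjoint id := by
    intro A hA B hB hAB
    obtain ⟨t, -, rfl⟩ := Finset.mem_image.1 hA
    obtain ⟨t', -, rfl⟩ := Finset.mem_image.1 hB
    refine Set.disjoint_left.2 fun v (hv : D.T.Reachable _ _) (hv' : D.T.Reachable _ _) => hAB ?_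
    have htt := hv.symm.trans hv'
    ext w
    exact ⟨fun hw => hw.trans htt, fun hw => hw.trans htt.symm⟩
  have hcov : (Set.univ : Set H.E) ⊆ ⋃ A ∈ s, H.inducedEdges A := by
    intro e _
    obtain ⟨u, v, he⟩ := H.exists_ends e
    have hu : u ∈ D.treeSet (D.nodeOf u) := SimpleGraph.Reachable.rfl
    exact Set.mem_iUnion₂.2 ⟨_, Finset.mem_image_of_mem _ (Finset.mem_univ (D.nodeOf u)),
      (mem_inducedEdges_iff he).2 ⟨hu, TreeCutDecomp.mem_treeSet_of_ends he hu⟩⟩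
  have h2 : H.numEdges ≤ ∑ A ∈ s, (H.inducedEdges A).ncard := by
    rw [numEdges, ← Nat.card_eq_fintype_card, ← Set.ncard_univ]
    exact (Set.ncard_le_ncard hcov).trans (Finset.set_ncard_biUnion_le _ _)
  refine h2.trans ((Finset.sum_le_sum fun A hA => ?_).trans (le_of_eq_of_le
    (Finset.mul_sum _ _ _).symm (Nat.mul_le_mul_left _
      (h.superadditive.sum_le hsd fun A _ => Set.subset_univ A))))
  obtain ⟨t, -, rfl⟩ := Finset.mem_image.1 hA
  exact h1 t

end IsSparse

end Multigraph

namespace Multigraph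

section Charge

variable {G : Multigraph} {M : Finset G.V}

/-- A nonempty connected vertex set that meets `M` or separates `M` into at least three parts. -/
def Essential (G : Multigraph) (M : Finset G.V) (W : Set G.V) : Prop :=
  G.ConnectedOn W ∧ W.Nonempty ∧ ((∃ m ∈ M, m ∈ W) ∨ G.Branching M W)

/-- The families of disjoint essential subsets of `X`. -/
def essentialFamilies (G : Multigraph) (M : Finset G.V) (X : Set G.V) :
    Finset (Finset (Set G.V)) :=
  Finset.univ.filter fun s => (s : Set (Set G.V)).PairwiseDisjoint id ∧
    ∀ W ∈ s, W ⊆ X ∧ G.Essential M W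

/-- The maximum number of disjoint essential subsets of `X`. -/
def charge (G : Multigraph) (M : Finset G.V) (X : Set G.V) : ℕ :=
  (G.essentialFamilies M X).sup Finset.card

theorem mem_essentialFamilies {X : Set G.V} {s : Finset (Set G.V)} :
    s ∈ G.essentialFamilies M X ↔ (s : Set (Set G.V)).PairwiseDisjoint id ∧
      ∀ W ∈ s, W ⊆ X ∧ G.Essential M W := by
  simp [essentialFamilies]

theorem exists_card_eq_charge (X : Set G.V) :
    ∃ s ∈ G.essentialFamilies M X, s.card = G.charge M X := by
  obtain ⟨s, hs, h⟩ := Finset.exists_mem_eq_sup (G.essentialFamilies M X)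
    ⟨∅, mem_essentialFamilies.2 (by simp)⟩ Finset.card
  exact ⟨s, hs, h.symm⟩

theorem charge_ne_zero {X W : Set G.V} (hWX : W ⊆ X) (hW : G.Essential M W) :
    G.charge M X ≠ 0 := by
  have : ({W} : Finset (Set G.V)).card ≤ G.charge M X :=
    Finset.le_sup (f := Finset.card) (mem_essentialFamilies.2 (by simp [hWX, hW]))
  rw [Finset.card_singleton] at this
  omega

theorem charge_ne_zero_of_mem {X : Set G.V} {m : G.V} (hm : m ∈ M) (hX : m ∈ X) :
    G.charge M X ≠ 0 :=
  charge_ne_zero (W := {m}) (by simpa) ⟨by rintro _ rfl _ rfl; exact .refl rfl, by simp,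
    .inl ⟨m, hm, rfl⟩⟩

theorem superadditive_charge : Superadditive (G.charge M) := by
  intro X Y hXY
  obtain ⟨s, hs, hsX⟩ := exists_card_eq_charge (M := M) X
  obtain ⟨t, ht, htY⟩ := exists_card_eq_charge (M := M) Y
  rw [mem_essentialFamilies] at hs ht
  have hd : ∀ A ∈ s, ∀ B ∈ t, Disjoint A B := fun A hA B hB =>
    hXY.mono (hs.2 A hA).1 (ht.2 B hB).1
  have hst : Disjoint s t := by
    refine Finset.disjoint_left.2 fun A hA hA' => ?_
    exact (hs.2 A hA).2.2.1.ne_empty (disjoint_self.1 (hd A hA A hA'))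
  rw [← hsX, ← htY, ← Finset.card_union_of_disjoint hst]
  refine Finset.le_sup (f := Finset.card) (mem_essentialFamilies.2 ⟨?_, ?_⟩)
  · rw [Finset.coe_union, Set.pairwiseDisjoint_union]
    exact ⟨hs.1, ht.1, fun A hA B hB _ => hd A hA B hB⟩
  · intro W hW
    rcases Finset.mem_union.1 hW with hW | hW
    · exact ⟨(hs.2 W hW).1.trans Set.subset_union_left, (hs.2 W hW).2⟩
    · exact ⟨(ht.2 W hW).1.trans Set.subset_union_right, (ht.2 W hW).2⟩

theorem charge_le (hG : G.Connected) (X : Set G.V) : G.charge M X ≤ 2 * M.card := by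
  obtain ⟨s, hs, hsX⟩ := exists_card_eq_charge (M := M) X
  rw [mem_essentialFamilies] at hs
  rw [← hsX, ← Finset.card_filter_add_card_filter_not (fun W => ∃ m ∈ M, m ∈ W), two_mul]
  refine Nat.add_le_add ?_ (card_branching_le hG _ M ?_
    (hs.1.subset (Finset.coe_subset.2 (Finset.filter_subset _ _))))
  · have := hG.1
    choose! f hf using fun (W : Set G.V) (h : ∃ m ∈ M, m ∈ W) => h
    refine Finset.card_le_card_of_injOn f
      (fun W hW => (hf W (Finset.mem_filter.1 hW).2).1) fun W hW W' hW' h => ?_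
    obtain ⟨hW, hW2⟩ := Finset.mem_filter.1 hW
    obtain ⟨hW', hW2'⟩ := Finset.mem_filter.1 hW'
    exact hs.1.elim_set hW hW' (f W) (hf W hW2).2 (h ▸ (hf W' hW2').2)
  · intro W hW
    obtain ⟨hW, hW2⟩ := Finset.mem_filter.1 hW
    exact ⟨(hs.2 W hW).2.1, (hs.2 W hW).2.2.2.resolve_left hW2⟩

end Charge

/-- A connected graph without excessive protrusions, bouquets and thetas, together with a nonempty
set `M` of vertices hitting every immersion model of a member of `F`. -/
structure IsReduced {ι : Type} (F : ι → Multigraph) (b c d : ℕ) (G : Multigraph)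
    (M : Finset G.V) : Prop where
  connected : G.Connected
  nonempty : M.Nonempty
  freeOn : ∀ X : Set G.V, (∀ m ∈ M, m ∉ X) → FFreeOn F G X
  not_excessive : ¬ HasExcessive F b c G
  not_bouquet : ¬ ∃ (U : Set G.V) (𝒮 : Set (Set G.V)), IsBouquet F d G U 𝒮
  not_theta : ¬ ∃ u v : G.V, IsTheta d G u v

namespace IsReduced

variable {ι : Type} {F : ι → Multigraph} {b c d : ℕ} {G : Multigraph} {M : Finset G.V}

theorem ncard_inducedEdges_le_of_connectedOn (h : IsReduced F b c d G M) {W : Set G.V}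
    (hW : G.ConnectedOn W) (hess : ¬ G.Essential M W) (hδ : (G.edgeBoundary W).ncard ≤ 2 * b) :
    (G.inducedEdges W).ncard ≤ 2 * b * c := by
  rcases W.eq_empty_or_nonempty with rfl | hne
  · simp [inducedEdges_empty]
  simp only [Essential, hW, hne, true_and, not_or, not_exists, not_and] at hess
  obtain ⟨hWM, hbr⟩ := hess
  set B : Set G.V := {v | ∀ m ∈ M, ¬ G.ReachIn Wᶜ v m} with hB
  have hWB : W ⊆ B := fun v hv m _ hvm => hvm.mem_left hv
  by_contra! hcon
  obtain ⟨v₀, hv₀⟩ := hne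
  have hcomp : G.component v₀ = Set.univ := Set.eq_univ_of_forall fun u => h.connected.2 u v₀
  refine h.not_excessive ⟨B, v₀, hWB hv₀, hcomp ▸ Set.subset_univ _, ⟨?_, ?_⟩, ?_, ?_⟩
  · refine (Set.ncard_le_ncard ?_).trans hδ
    rintro e ⟨u, v, he, hu, hv⟩
    simp only [hB, Set.mem_ofPred_eq, not_forall, not_not] at hv
    obtain ⟨m, hm, hvm⟩ := hv
    refine ⟨u, v, he, by_contra fun huW => hu m hm ?_, hvm.mem_left⟩
    exact .cons he huW hvm
  · exact h.freeOn B fun m hm hmB => hmB m hm (.refl (hWM m hm))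
  · exact hcon.trans_le (Set.ncard_le_ncard fun e he v hv => hWB (he v hv))
  · refine csSup_le' ?_
    rintro n ⟨f, hfB, hf⟩
    by_contra! hn
    have hex : ∀ i, ∃ m ∈ M, G.ReachIn Wᶜ (f i) m := fun i => by
      simpa [hB] using (hfB i).2
    choose g hgM hg using hex
    refine hbr ⟨fun i => g (Fin.castLE hn i), fun i => ⟨hgM _, (hg _).mem_right⟩,
      fun i j hij hr => ?_⟩
    refine hf _ _ (fun hc => hij (Fin.castLE_injective hn hc)) ?_
    refine ((((hg _).trans hr).trans (hg _).symm).inter (C := Bᶜ) (hfB _).2 ?_).mono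
      (fun x hx => hcomp ▸ ⟨trivial, hx.2⟩)
    intro e x y he hx hxW hyW hyB
    simp only [hB, Set.mem_compl_iff, Set.mem_ofPred_eq, not_forall, not_not] at hx
    obtain ⟨m, hm, hxm⟩ := hx
    exact hyB m hm (.cons (he.trans Sym2.eq_swap) hyW hxm)

theorem not_essential_of_charge {X W : Set G.V} (hX : G.charge M X = 0) (hWX : W ⊆ X) :
    ¬ G.Essential M W := fun h => charge_ne_zero hWX h hX

theorem ncard_inducedEdges_le (h : IsReduced F b c d G M) {X : Set G.V} (hX : G.charge M X = 0)
    (hδ : (G.edgeBoundary X).ncard ≤ 2 * b) :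
    (G.inducedEdges X).ncard ≤ (G.edgeBoundary X).ncard * (2 * b * c) := by
  obtain ⟨m, hm⟩ := h.nonempty
  have hex : ∀ e ∈ G.inducedEdges X, ∃ e' ∈ G.edgeBoundary X, ∃ x y, G.ends e' = s(x, y) ∧
      y ∉ X ∧ e ∈ G.inducedEdges (G.reachSet X x) := by
    intro e he
    obtain ⟨u, v, huv⟩ := G.exists_ends e
    obtain ⟨hu, hv⟩ := (mem_inducedEdges_iff huv).1 he
    obtain ⟨e', x, y, he', hx, hy, -, -⟩ := (h.connected.reachIn_univ u m).exists_exit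
      (C := G.reachSet X u) (.refl hu) fun hmX => charge_ne_zero_of_mem hm hmX.mem_right hX
    have hy' : y ∉ X := fun hyX => hy (mem_reachSet_of_edge he' hx hyX)
    exact ⟨e', ⟨x, y, he', hx.mem_right, hy'⟩, x, y, he', hy', (mem_inducedEdges_iff huv).2
      ⟨ReachIn.symm hx, (ReachIn.symm hx).trans (.edge huv hu hv)⟩⟩
  have := h.connected.1
  choose! f hf g y hg hy hgf using hex
  have hcard : ∀ e' ∈ (G.edgeBoundary X).toFinset,
      ((G.inducedEdges X).toFinset.filter fun e => f e = e').card ≤ 2 * b * c := by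
    intro e' he'
    obtain ⟨p, q, hpq, hp, hq⟩ := Set.mem_toFinset.1 he'
    rw [← Set.ncard_coe_finset]
    refine (Set.ncard_le_ncard ?_).trans (h.ncard_inducedEdges_le_of_connectedOn
      (W := G.reachSet X p) connectedOn_reachSet
      (not_essential_of_charge hX reachSet_subset)
      ((Set.ncard_le_ncard edgeBoundary_reachSet_subset).trans hδ))
    intro e he
    obtain ⟨hem, rfl⟩ := Finset.mem_filter.1 he
    replace he := Set.mem_toFinset.1 hem
    have := hg e he
    rw [hpq, Sym2.eq_iff] at this
    rcases this with ⟨rfl, rfl⟩ | ⟨rfl, rfl⟩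
    · exact hgf e he
    · exact absurd hp (hy e he)
  have := Finset.card_le_mul_card_image_of_maps_to
    (s := (G.inducedEdges X).toFinset) (t := (G.edgeBoundary X).toFinset) (f := f)
    (fun e he => by simpa using hf e (by simpa using he)) _ hcard
  rw [Set.ncard_eq_toFinset_card', Set.ncard_eq_toFinset_card', mul_comm]
  exact this

theorem ncard_parallelEdges_lt (h : IsReduced F b c d G M) {u v : G.V} (huv : u ≠ v) :
    (G.parallelEdges u v).ncard < d :=
  not_le.1 fun hd => h.not_theta ⟨u, v, huv, hd⟩

theorem ncard_inducedEdges_le_of_card_le (h : IsReduced F b c d G M) {a : ℕ} {Z : Finset G.V}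
    (hZ : Z.card ≤ a) : (G.inducedEdges Z).ncard ≤ a * a * d := by
  have hsub : G.inducedEdges Z ⊆ ⋃ p ∈ Z.offDiag, G.parallelEdges p.1 p.2 := by
    intro e he
    obtain ⟨u, v, huv⟩ := G.exists_ends e
    obtain ⟨hu, hv⟩ := (mem_inducedEdges_iff huv).1 he
    refine Set.mem_iUnion₂.2 ⟨(u, v), Finset.mem_offDiag.2 ⟨hu, hv, ?_⟩, huv⟩
    rintro (rfl : u = v)
    exact G.loopless e (huv ▸ Sym2.mk_isDiag_iff.2 rfl)
  refine (Set.ncard_le_ncard hsub).trans ((Finset.set_ncard_biUnion_le _ _).trans ?_)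
  refine (Finset.sum_le_card_nsmul _ _ d fun p hp =>
    (h.ncard_parallelEdges_lt (Finset.mem_offDiag.1 hp).2.2).le).trans ?_
  rw [smul_eq_mul]
  refine Nat.mul_le_mul_right _ ?_
  rw [Finset.offDiag_card]
  exact (Nat.sub_le _ _).trans (Nat.mul_le_mul hZ hZ)

end IsReduced

end Multigraph

theorem Set.exists_injOn_fin {α : Type} [Finite α] {S : Set α} {n : ℕ} (h : S.ncard ≤ n) :
    ∃ f : α → Fin (n + 1), Set.InjOn f S := by
  have : Fintype α := Fintype.ofFinite α
  obtain ⟨f⟩ := Function.Embedding.nonempty_of_card_le (α := S) (β := Fin (n + 1)) (by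
    rw [← Nat.card_eq_fintype_card, Fintype.card_fin]
    exact Nat.le_succ_of_le h)
  refine ⟨fun v => if hv : v ∈ S then f ⟨v, hv⟩ else 0, fun u hu v hv huv => ?_⟩
  simp only [dif_pos hu, dif_pos hv] at huv
  exact congrArg Subtype.val (f.injective huv)

theorem Sym2.map_injOn {α β : Type} {f : α → β} {S : Set α} (hf : Set.InjOn f S) {p q : Sym2 α}
    (hp : ∀ x ∈ p, x ∈ S) (hq : ∀ x ∈ q, x ∈ S) (h : p.map f = q.map f) : p = q := by
  induction p using Sym2.ind with | _ x y =>
  induction q using Sym2.ind with | _ z w =>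
  have hx := hp x (by simp)
  have hy := hp y (by simp)
  have hz := hq z (by simp)
  have hw := hq w (by simp)
  rw [Sym2.map_mk, Sym2.map_mk, Sym2.eq_iff] at h
  rcases h with ⟨h1, h2⟩ | ⟨h1, h2⟩
  · rw [hf hx hz h1, hf hy hw h2]
  · rw [hf hx hw h1, hf hy hz h2, Sym2.eq_swap]

namespace Multigraph

variable {G : Multigraph}

theorem exists_bijOn_of_fiber_card_eq {E P : Type} [Finite E] {A B : Set E} {f g : E → P}
    (h : ∀ p, Nat.card {e : A // f e = p} = Nat.card {e : B // g e = p}) :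
    ∃ ψ : E → E, Set.BijOn ψ A B ∧ ∀ e ∈ A, g (ψ e) = f e := by
  have he : ∀ p, Nonempty ({e : A // f e = p} ≃ {e : B // g e = p}) := fun p =>
    (Finite.card_eq).1 (h p)
  let Ψ : A ≃ B := Equiv.ofFiberEquiv (f := fun e : A => f e) (g := fun e : B => g e)
    fun p => (he p).some
  have hΨ : ∀ e : A, g (Ψ e) = f e := fun e =>
    Equiv.ofFiberEquiv_map (f := fun e : A => f e) (g := fun e : B => g e) _ e
  refine ⟨fun e => if he : e ∈ A then Ψ ⟨e, he⟩ else e, ⟨?_, ?_, ?_⟩, ?_⟩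
  · intro e he
    simp only [dif_pos he, Subtype.coe_prop]
  · intro e he e' he' hee
    simp only [dif_pos he, dif_pos he'] at hee
    exact congrArg Subtype.val (Ψ.injective (Subtype.ext hee))
  · intro e he
    refine ⟨Ψ.symm ⟨e, he⟩, (Ψ.symm ⟨e, he⟩).2, ?_⟩
    simp
  · intro e he
    simp only [dif_pos he, hΨ]

/-- The labelling of the vertices by `σ` inside `S` and by `ζ` outside `S`. -/
def label {P Q : Type} (S : Set G.V) (ζ : G.V → P) (σ : G.V → Q) (v : G.V) : P ⊕ Q :=
  if v ∈ S then .inr (σ v) else .inl (ζ v)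

theorem label_injOn {P Q : Type} {S U : Set G.V} {ζ : G.V → P} {σ : G.V → Q}
    (hζ : Set.InjOn ζ U) (hσ : Set.InjOn σ S) : Set.InjOn (label S ζ σ) (U ∪ S) := by
  intro u hu v hv huv
  simp only [label] at huv
  split_ifs at huv with h1 h2 h2
  · exact hσ h1 h2 (Sum.inr_injective huv)
  · exact hζ (hu.resolve_right h1) (hv.resolve_right h2) (Sum.inl_injective huv)

/-- The number of edges of `G[U ∪ S]` with given labels of the endpoints. -/
def labelCount {P Q : Type} (G : Multigraph) (U S : Set G.V) (ζ : G.V → P) (σ : G.V → Q)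
    (p : Sym2 (P ⊕ Q)) : ℕ :=
  Nat.card {e : G.inducedEdges (U ∪ S) // (G.ends e).map (label S ζ σ) = p}

theorem labelCount_lt {P Q : Type} {U S : Set G.V} {ζ : G.V → P} {σ : G.V → Q}
    (hζ : Set.InjOn ζ U) (hσ : Set.InjOn σ S) {d : ℕ} (hd : 0 < d)
    (hθ : ∀ u v : G.V, u ≠ v → (G.parallelEdges u v).ncard < d) (p : Sym2 (P ⊕ Q)) :
    G.labelCount U S ζ σ p < d := by
  rcases isEmpty_or_nonempty
    {e : G.inducedEdges (U ∪ S) // (G.ends e).map (label S ζ σ) = p} with h | ⟨⟨e₀, he₀⟩⟩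
  · rwa [labelCount, Nat.card_of_isEmpty]
  · obtain ⟨u, v, huv⟩ := G.exists_ends e₀
    have hne : u ≠ v := by
      rintro rfl
      exact G.loopless e₀ (huv ▸ Sym2.mk_isDiag_iff.2 rfl)
    refine lt_of_le_of_lt ?_ (hθ u v hne)
    refine Nat.card_le_card_of_injective (β := G.parallelEdges u v)
      (fun e => ⟨e.1.1, ?_⟩) fun e e' h =>
        Subtype.ext (Subtype.ext (Subtype.mk.inj h))
    exact (Sym2.map_injOn (label_injOn hζ hσ) e.1.2 e₀.2 (e.2.trans he₀.symm)).trans huv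

theorem inducedIsoFixing_of_labelCount_eq {P Q : Type} {U S T : Set G.V} {ζ : G.V → P}
    {σ τ : G.V → Q} (hSU : Disjoint S U) (hTU : Disjoint T U) (hζ : Set.InjOn ζ U)
    (hσ : Set.InjOn σ S) (hτ : Set.InjOn τ T) (himg : σ '' S = τ '' T)
    (hcount : G.labelCount U S ζ σ = G.labelCount U T ζ τ) : InducedIsoFixing G U S T := by
  have hex : ∀ v ∈ S, ∃ w ∈ T, τ w = σ v := fun v hv =>
    himg.subset (Set.mem_image_of_mem σ hv)
  rcases isEmpty_or_nonempty G.V with hV | hV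
  · exact ⟨id, by simp [Set.eq_empty_of_isEmpty], fun _ _ => rfl, id, by
      simp [Set.eq_empty_of_isEmpty S, Set.eq_empty_of_isEmpty T, Set.bijOn_id], by simp⟩
  choose! ρ hρT hρ using hex
  set φ : G.V → G.V := fun v => if v ∈ S then ρ v else v with hφ
  have hφS : ∀ v ∈ S, φ v = ρ v := fun v hv => if_pos hv
  have hφU : ∀ u ∈ U, φ u = u := fun u hu => if_neg fun hS => Set.disjoint_left.1 hSU hS hu
  have hlabel : ∀ v ∈ U ∪ S, label T ζ τ (φ v) = label S ζ σ v := by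
    rintro v (hv | hv)
    · rw [hφU v hv, label, label, if_neg fun h => Set.disjoint_left.1 hTU h hv,
        if_neg fun h => Set.disjoint_left.1 hSU h hv]
    · rw [hφS v hv, label, label, if_pos hv, if_pos (hρT v hv), hρ v hv]
  have hmaps : Set.MapsTo φ (U ∪ S) (U ∪ T) := by
    rintro v (hv | hv)
    · exact .inl ((hφU v hv).symm ▸ hv)
    · exact .inr ((hφS v hv).symm ▸ hρT v hv)
  refine ⟨φ, ⟨hmaps, ?_, ?_⟩, hφU, ?_⟩
  · intro u hu v hv huv
    refine label_injOn hζ hσ hu hv ?_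
    rw [← hlabel u hu, ← hlabel v hv, huv]
  · rintro w (hw | hw)
    · exact ⟨w, .inl hw, hφU w hw⟩
    · obtain ⟨v, hv, hvw⟩ := himg ▸ Set.mem_image_of_mem τ hw
      exact ⟨v, .inr hv, (hφS v hv).trans (hτ (hρT v hv) hw ((hρ v hv).trans hvw))⟩
  · obtain ⟨ψ, hψ, hψe⟩ := exists_bijOn_of_fiber_card_eq
      (f := fun e => (G.ends e).map (label S ζ σ)) (g := fun e => (G.ends e).map (label T ζ τ))
      (fun p => congrFun hcount p)
    refine ⟨ψ, hψ, fun e he => Sym2.map_injOn (label_injOn hζ hτ) (hψ.mapsTo he) ?_ ?_⟩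
    · intro x hx
      obtain ⟨y, hy, rfl⟩ := Sym2.mem_map.1 hx
      exact hmaps (he y hy)
    · rw [Sym2.map_map]
      refine (hψe e he).trans (Sym2.map_congr fun x hx => (hlabel x (he x hx)).symm)

theorem ConnectedOn.ncard_le {S : Set G.V} (hS : G.ConnectedOn S) :
    S.ncard ≤ 2 * (G.inducedEdges S).ncard + 1 := by
  by_cases h : S.Subsingleton
  · have := (Set.ncard_le_one_iff_subsingleton (s := S)).2 h
    omega
  · rw [Set.not_subsingleton_iff] at h
    have hsub : S ⊆ ⋃ e ∈ (G.inducedEdges S).toFinset, {v | v ∈ G.ends e} := by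
      intro v hv
      obtain ⟨w, hw, hwv⟩ := h.exists_ne v
      obtain ⟨e, x, y, he, rfl, -, hy, hx⟩ := (hS v hv w hw).exists_exit (C := {v}) rfl hwv
      exact Set.mem_iUnion₂.2 ⟨e, by
        simpa using (mem_inducedEdges_iff he).2 ⟨hx, hy.mem_left⟩, by simp [he]⟩
    refine (Set.ncard_le_ncard hsub).trans ((Finset.set_ncard_biUnion_le _ _).trans ?_)
    rw [Set.ncard_eq_toFinset_card' (G.inducedEdges S)]
    refine (Finset.sum_le_card_nsmul _ _ 2 fun e _ => ?_).trans (by rw [smul_eq_mul]; omega)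
    obtain ⟨u, v, huv⟩ := G.exists_ends e
    have : {w | w ∈ G.ends e} = {u, v} := by ext; simp [huv]
    rw [this]
    exact (Set.ncard_insert_le u {v}).trans (by simp)

end Multigraph

theorem IsBouquetFamily.ncard_lt {ι : Type} {F : ι → Multigraph} {d : ℕ} {G : Multigraph}
    (hG : ¬ ∃ (U : Set G.V) (𝒮 : Set (Set G.V)), IsBouquet F d G U 𝒮) {U : Set G.V}
    {𝒮 : Set (Set G.V)} (h𝒮 : IsBouquetFamily F G U 𝒮) : 𝒮.ncard < d := by
  by_contra! hd
  obtain ⟨𝒯, h𝒯, hmax⟩ := (Set.toFinite {𝒯 | IsBouquetFamily F G U 𝒯}).exists_le_maximal h𝒮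
  refine hG ⟨U, 𝒯, hmax.prop, hd.trans (Set.ncard_le_ncard h𝒯), fun 𝒯' h h' => ?_⟩
  exact (hmax.eq_of_le h' h).symm

namespace Multigraph.IsReduced

variable {ι : Type} {F : ι → Multigraph} {b c d : ℕ} {G : Multigraph} {M : Finset G.V}

/-- The isomorphism types of thin connected sets attached to subsets of a set of size `a`. -/
abbrev BouquetType (a K d : ℕ) : Type :=
  Set (Fin (a + 1)) × Set (Fin (2 * K + 1 + 1)) ×
    (Sym2 (Fin (a + 1) ⊕ Fin (2 * K + 1 + 1)) → Fin d)

theorem card_le_of_connectedOn (h : IsReduced F b c d G M) (hd : 0 < d) {a K : ℕ}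
    {Z : Finset G.V} (hZ : Z.card ≤ a) {s : Finset (Set G.V)}
    (hs : (s : Set (Set G.V)).PairwiseDisjoint id)
    (hS : ∀ S ∈ s, S.Nonempty ∧ G.ConnectedOn S ∧ IsProtrusion F G 2 S ∧ G.nbhd S ⊆ Z ∧
      (G.inducedEdges S).ncard ≤ K) : s.card ≤ d * Fintype.card (BouquetType a K d) := by
  obtain ⟨ζ, hζ⟩ := Set.exists_injOn_fin ((Set.ncard_coe_finset Z).trans_le hZ)
  have hex : ∀ S ∈ s, ∃ σ : G.V → Fin (2 * K + 1 + 1), Set.InjOn σ S := by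
    intro S hSs
    refine Set.exists_injOn_fin ((hS S hSs).2.1.ncard_le.trans ?_)
    have := (hS S hSs).2.2.2.2
    omega
  choose! σ hσ using hex
  have hθ : ∀ u v : G.V, u ≠ v → (G.parallelEdges u v).ncard < d := fun u v huv =>
    h.ncard_parallelEdges_lt huv
  set code : Set G.V → BouquetType a K d := fun S => (ζ '' G.nbhd S, σ S '' S, fun p =>
    ⟨min (d - 1) (G.labelCount (G.nbhd S) S ζ (σ S) p), by omega⟩) with hcode
  have hfib : ∀ p ∈ (Finset.univ : Finset (BouquetType a K d)),
      (s.filter fun S => code S = p).card ≤ d := by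
    intro p _
    rcases (s.filter fun S => code S = p).eq_empty_or_nonempty with h0 | ⟨S₀, hS₀⟩
    · simp [h0]
    obtain ⟨hS₀s, rfl⟩ := Finset.mem_filter.1 hS₀
    have hζS : ∀ S ∈ s, Set.InjOn ζ (G.nbhd S) := fun S hSs => hζ.mono (hS S hSs).2.2.2.1
    have hnb : ∀ S ∈ s, code S = code S₀ → G.nbhd S = G.nbhd S₀ := by
      intro S hSs hSc
      exact (hζ.image_eq_image_iff (hS S hSs).2.2.2.1 (hS S₀ hS₀s).2.2.2.1).1
        (congrArg Prod.fst hSc)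
    have hdisj : ∀ S : Set G.V, Disjoint S (G.nbhd S) := fun S =>
      Set.disjoint_left.2 fun v hv hv' => hv'.1 hv
    rw [← Set.ncard_coe_finset]
    refine (IsBouquetFamily.ncard_lt h.not_bouquet (U := G.nbhd S₀) ⟨?_, ?_, ?_⟩).le
    · intro S hSm
      obtain ⟨hSs, hSc⟩ := Finset.mem_filter.1 hSm
      obtain ⟨h1, h2, h3, -⟩ := hS S hSs
      exact ⟨h1, h3, hnb S hSs hSc, h2⟩
    · exact fun S hSm T hTm hST =>
        hs (Finset.mem_filter.1 hSm).1 (Finset.mem_filter.1 hTm).1 hST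
    · intro S hSm T hTm
      obtain ⟨hSs, hSc⟩ := Finset.mem_filter.1 hSm
      obtain ⟨hTs, hTc⟩ := Finset.mem_filter.1 hTm
      have hST := hSc.trans hTc.symm
      have hlt := fun S hSs => labelCount_lt (hζS S hSs) (hσ S hSs) hd hθ
      have hc : G.labelCount (G.nbhd S) S ζ (σ S) = G.labelCount (G.nbhd T) T ζ (σ T) := by
        ext p
        have h1 := congrArg Fin.val (congrFun (congrArg (fun q => q.2.2) hST) p)
        simp only [hcode] at h1
        have h2 := hlt S hSs p
        have h3 := hlt T hTs p
        omega
      rw [← hnb S hSs hSc]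
      have hnST : G.nbhd T = G.nbhd S := (hnb T hTs hTc).trans (hnb S hSs hSc).symm
      rw [hnST] at hc
      exact inducedIsoFixing_of_labelCount_eq (hdisj S) (hnST ▸ hdisj T) (hζS S hSs)
        (hσ S hSs) (hσ T hTs) (congrArg (fun q => q.2.1) hST) hc
  exact Finset.card_le_mul_card_image_of_maps_to (fun S _ => Finset.mem_univ (code S)) _ hfib

theorem card_le_of_nbhd_subset (h : IsReduced F b c d G M) (hb : 0 < b) (hd : 0 < d) {a : ℕ}
    {Z : Finset G.V} (hZ : Z.card ≤ a) {s : Finset (Set G.V)}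
    (hs : (s : Set (Set G.V)).PairwiseDisjoint id)
    (hS : ∀ S ∈ s, S.Nonempty ∧ G.charge M S = 0 ∧ (G.edgeBoundary S).ncard ≤ 2 ∧
      G.nbhd S ⊆ Z) : s.card ≤ d * Fintype.card (BouquetType a (2 * b * c) d) := by
  have := h.connected.1
  choose! f hf using fun S hSs => (hS S hSs).1
  have hinj : Set.InjOn (fun S => G.reachSet S (f S)) s := by
    intro S hSs T hTs hST
    have hST : G.reachSet S (f S) = G.reachSet T (f T) := hST
    exact hs.elim_set hSs hTs (f S) (hf S hSs)
      (reachSet_subset (hST.subset (ReachIn.refl (hf S hSs))))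
  rw [← Finset.card_image_of_injOn hinj]
  refine h.card_le_of_connectedOn hd hZ ?_ ?_
  · rw [Finset.coe_image]
    rintro _ ⟨S, hSs, rfl⟩ _ ⟨T, hTs, rfl⟩ hST
    exact (hs hSs hTs fun he => hST (he ▸ rfl)).mono reachSet_subset reachSet_subset
  · intro S' hS'
    obtain ⟨S, hSs, rfl⟩ := Finset.mem_image.1 hS'
    obtain ⟨-, h0, hδ, hN⟩ := hS S hSs
    have hδ' := (Set.ncard_le_ncard
      (edgeBoundary_reachSet_subset (G := G) (S := S) (v := f S))).trans hδ
    refine ⟨⟨f S, .refl (hf S hSs)⟩, connectedOn_reachSet, ⟨hδ', h.freeOn _ fun m hm hmS => ?_⟩,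
      nbhd_reachSet_subset.trans hN, h.ncard_inducedEdges_le_of_connectedOn connectedOn_reachSet
        (not_essential_of_charge h0 reachSet_subset) (by omega)⟩
    exact charge_ne_zero_of_mem hm (reachSet_subset hmS) h0

end Multigraph.IsReduced

namespace Multigraph

variable {G : Multigraph}

section DeleteEdges

variable {D : Finset G.E}

theorem Walk.mem_support_of_mem_edges {u v : G.V} (p : Walk G u v) {e : G.E} (he : e ∈ p.edges)
    {x : G.V} (hx : x ∈ G.ends e) : x ∈ p.support := by
  induction p with
  | nil => simp [Walk.edges] at he
  | cons e' h p ih =>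
    rcases List.mem_cons.1 he with rfl | he
    · rw [h, Sym2.mem_iff] at hx
      rcases hx with rfl | rfl
      · exact List.mem_cons_self
      · exact List.mem_cons_of_mem _ p.start_mem_support
    · exact List.mem_cons_of_mem _ (ih he)

theorem Walk.exists_deleteEdges {u v : G.V} (p : Walk G u v) (hp : ∀ e ∈ p.edges, e ∉ D) :
    ∃ q : Walk (G.deleteEdges D) u v, q.support = p.support ∧
      q.edges.map Subtype.val = p.edges := by
  induction p with
  | nil v => exact ⟨.nil (G := G.deleteEdges D) v, rfl, rfl⟩
  | cons e h p ih =>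
    obtain ⟨q, hq, hq'⟩ := ih fun e' he' => hp e' (List.mem_cons_of_mem _ he')
    refine ⟨.cons (G := G.deleteEdges D) ⟨e, hp e List.mem_cons_self⟩ h q, ?_, ?_⟩
    · exact congrArg (List.cons _) hq
    · exact congrArg (List.cons e) hq'

theorem containsImm_deleteEdges {Q : Multigraph} (I : Immersion Q G)
    (hI : ∀ e, ∀ x ∈ (I.emap e).edges, x ∉ D) : ContainsImm (G.deleteEdges D) Q := by
  choose q hq hq' using fun e => (I.emap e).exists_deleteEdges (hI e)
  refine ⟨⟨I.vmap, I.vmap_inj, I.esrc, I.etgt, I.ends_eq, q, fun e => ?_,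
    fun e e' hee x hx hx' => ?_⟩⟩
  · exact (congrArg List.Nodup (hq e)).mpr (I.emap_path e)
  · refine I.edge_disjoint e e' hee x.1 ?_ ?_
    · exact hq' e ▸ List.mem_map_of_mem hx
    · exact hq' e' ▸ List.mem_map_of_mem hx'

theorem edgeBoundary_eq_image_deleteEdges {X : Set G.V} (hX : ∀ e ∈ D, ∀ v ∈ G.ends e, v ∉ X) :
    G.edgeBoundary X = Subtype.val '' (G.deleteEdges D).edgeBoundary X := by
  ext e
  constructor
  · rintro ⟨u, v, he, hu, hv⟩
    exact ⟨⟨e, fun hD => hX e hD u (by simp [he]) hu⟩, ⟨u, v, he, hu, hv⟩, rfl⟩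
  · rintro ⟨e, he, rfl⟩
    exact he

theorem ncard_edgeBoundary_deleteEdges {X : Set G.V} (hX : ∀ e ∈ D, ∀ v ∈ G.ends e, v ∉ X) :
    (G.edgeBoundary X).ncard = ((G.deleteEdges D).edgeBoundary X).ncard :=
  (congrArg Set.ncard (edgeBoundary_eq_image_deleteEdges hX)).trans
    (Set.ncard_image_of_injective _ Subtype.val_injective)

theorem nbhd_subset_nbhd_deleteEdges {X : Set G.V} (hX : ∀ e ∈ D, ∀ v ∈ G.ends e, v ∉ X) :
    G.nbhd X ⊆ (G.deleteEdges D).nbhd X := by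
  rintro u ⟨hu, e, v, hv, he⟩
  exact ⟨hu, ⟨e, fun hD => hX e hD v (by simp [he]) hv⟩, v, hv, he⟩

theorem ncard_inducedEdges_deleteEdges_le (X : Set G.V) :
    ((G.deleteEdges D).inducedEdges X).ncard ≤ (G.inducedEdges X).ncard :=
  Set.ncard_le_ncard_of_injOn Subtype.val (fun _ he => he) Subtype.val_injective.injOn

theorem numEdges_deleteEdges_add : (G.deleteEdges D).numEdges + D.card = G.numEdges := by
  have h : (G.deleteEdges D).numEdges = Fintype.card {e : G.E // e ∉ D} :=
    Fintype.card_congr (Equiv.refl _)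
  rw [h, Fintype.card_subtype_compl, Fintype.card_coe]
  exact Nat.sub_add_cancel (Finset.card_le_univ D)

/-- The vertices incident to an edge of `D`. -/
def endpoints (G : Multigraph) (D : Finset G.E) : Finset G.V :=
  D.biUnion fun e => (G.ends e).toFinset

theorem mem_endpoints {v : G.V} : v ∈ G.endpoints D ↔ ∃ e ∈ D, v ∈ G.ends e := by
  simp [endpoints]

theorem card_endpoints_le : (G.endpoints D).card ≤ 2 * D.card := by
  rw [mul_comm]
  exact Finset.card_biUnion_le_card_mul _ _ _ fun e _ =>
    (Sym2.card_toFinset_of_not_isDiag _ (G.loopless e)).le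

end DeleteEdges

theorem exists_deleteEdges_fFree {ι : Type} {F : ι → Multigraph} (hedge : ∀ i, Nonempty (F i).E)
    (G : Multigraph) : ∃ D : Finset G.E, D.card = OPT F G ∧ FFree F (G.deleteEdges D) := by
  refine Nat.sInf_mem (s := {k | ∃ D : Finset G.E, D.card = k ∧ FFree F (G.deleteEdges D)})
    ⟨_, Finset.univ, rfl, ?_⟩
  rintro i ⟨I⟩
  obtain ⟨e⟩ := hedge i
  have key : ∀ u v : (G.deleteEdges Finset.univ).V, u ≠ v → ¬ Nonempty (Walk _ u v) := by
    rintro u v huv ⟨p⟩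
    cases p with
    | nil => exact huv rfl
    | cons e => exact e.2 (Finset.mem_univ _)
  refine key _ _ (fun h => (F i).loopless e ?_) ⟨I.emap e⟩
  rw [I.ends_eq e, Sym2.mk_isDiag_iff]
  exact I.vmap_inj h

theorem exists_treeCutDecomp (G : Multigraph) : Nonempty (TreeCutDecomp G) := by
  let r : Setoid G.V := ⟨G.Reachable, fun v => ⟨.nil v⟩,
    fun h => reachIn_univ.1 (reachIn_univ.2 h).symm,
    fun h h' => reachIn_univ.1 ((reachIn_univ.2 h).trans (reachIn_univ.2 h'))⟩
  refine ⟨{ N := Quotient r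
            fintypeN := Fintype.ofFinite _
            T := ⊥
            acyclic := SimpleGraph.isAcyclic_bot
            bag := fun t => Finset.univ.filter fun v => (⟦v⟧ : Quotient r) = t
            nodeOf := fun v => ⟦v⟧
            mem_bag := by simp
            bag_disjoint := ?_
            comp_compat := ?_
            trees_used := ?_ }⟩
  · intro t t' htt
    rw [Finset.disjoint_left]
    intro v hv hv'
    exact htt ((Finset.mem_filter.1 hv).2.symm.trans (Finset.mem_filter.1 hv').2)
  · intro u v
    rw [SimpleGraph.reachable_bot, Quotient.eq]
    rfl
  · intro t
    obtain ⟨v, rfl⟩ := Quotient.exists_rep t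
    exact ⟨v, SimpleGraph.Reachable.rfl⟩

theorem exists_width_eq_tcw (G : Multigraph) : ∃ D : TreeCutDecomp G, D.width = tcw G :=
  Nat.sInf_mem (s := {k | ∃ D : TreeCutDecomp G, D.width = k})
    ⟨_, G.exists_treeCutDecomp.some, rfl⟩

theorem freeOn_of_endpoints {ι : Type} {F : ι → Multigraph} {D : Finset G.E}
    (hD : FFree F (G.deleteEdges D)) {X : Set G.V} (hX : ∀ m ∈ G.endpoints D, m ∉ X) :
    FFreeOn F G X := by
  rintro i ⟨I, -, hI⟩
  refine hD i (containsImm_deleteEdges I fun e x hx hxD => ?_)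
  obtain ⟨u, v, huv⟩ := G.exists_ends x
  have hu : u ∈ G.ends x := by simp [huv]
  exact hX u (mem_endpoints.2 ⟨x, hxD, hu⟩) (hI e u (Walk.mem_support_of_mem_edges _ hx hu))

/-- The number of disjoint thin sets attached to `a` vertices of a reduced graph. -/
def IsReduced.thinBound (a b c d : ℕ) : ℕ :=
  d * Fintype.card (IsReduced.BouquetType a (2 * b * c) d)

theorem IsReduced.isSparse {ι : Type} {F : ι → Multigraph} {b c d : ℕ} {D : Finset G.E}
    (h : IsReduced F b c d G (G.endpoints D)) {a : ℕ} (hab : a ≤ b) (hb : 0 < b) (hd : 0 < d) :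
    (G.deleteEdges D).IsSparse (G.charge (G.endpoints D)) a (2 * a * (2 * b * c)) (a * a * d)
      (thinBound a b c d) := by
  have hfree : ∀ X : Set G.V, G.charge (G.endpoints D) X = 0 →
      ∀ e ∈ D, ∀ v ∈ G.ends e, v ∉ X := fun X hX e he v hv hvX =>
    charge_ne_zero_of_mem (mem_endpoints.2 ⟨e, he, hv⟩) hvX hX
  have h1 : ∀ X : Set G.V, G.charge (G.endpoints D) X = 0 →
      ((G.deleteEdges D).edgeBoundary X).ncard ≤ 2 * a →
      ((G.deleteEdges D).inducedEdges X).ncard ≤ 2 * a * (2 * b * c) := by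
    intro X hX hδ
    rw [← ncard_edgeBoundary_deleteEdges (hfree X hX)] at hδ
    exact (ncard_inducedEdges_deleteEdges_le X).trans
      ((h.ncard_inducedEdges_le hX (hδ.trans (Nat.mul_le_mul_left 2 hab))).trans
        (Nat.mul_le_mul_right _ hδ))
  have h2 : ∀ Z : Finset G.V, Z.card ≤ a → ∀ s : Finset (Set G.V),
      (s : Set (Set G.V)).PairwiseDisjoint id →
      (∀ S ∈ s, S.Nonempty ∧ G.charge (G.endpoints D) S = 0 ∧
        ((G.deleteEdges D).edgeBoundary S).ncard ≤ 2 ∧ (G.deleteEdges D).nbhd S ⊆ (Z : Set G.V)) →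
      s.card ≤ thinBound a b c d := by
    intro Z hZ s hs hS
    refine h.card_le_of_nbhd_subset hb hd hZ hs fun S hSs => ?_
    obtain ⟨hne, h0, hδ, hN⟩ := hS S hSs
    exact ⟨hne, h0, (ncard_edgeBoundary_deleteEdges (hfree S h0)).trans_le hδ,
      (nbhd_subset_nbhd_deleteEdges (hfree S h0)).trans hN⟩
  have h3 : ∀ Z : Finset G.V, Z.card ≤ a →
      ((G.deleteEdges D).inducedEdges (Z : Set G.V)).ncard ≤ a * a * d := fun Z hZ =>
    (ncard_inducedEdges_deleteEdges_le _).trans (h.ncard_inducedEdges_le_of_card_le hZ)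
  exact ⟨superadditive_charge (G := G) (M := G.endpoints D), h1, h2, h3⟩

theorem IsReduced.charge_treeSet_ne_zero {ι : Type} {F : ι → Multigraph} {b c d : ℕ}
    {D : Finset G.E} (h : IsReduced F b c d G (G.endpoints D))
    (𝒟 : TreeCutDecomp (G.deleteEdges D)) (t : 𝒟.N) :
    G.charge (G.endpoints D) (𝒟.treeSet t) ≠ 0 := by
  intro h0
  obtain ⟨v, hv⟩ := 𝒟.trees_used t
  obtain ⟨m, hm⟩ := h.nonempty
  obtain ⟨e, x, y, he, hx, hy, -, -⟩ := (h.connected.reachIn_univ v m).exists_exit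
    (C := 𝒟.treeSet t) hv.symm fun hmt => charge_ne_zero_of_mem hm hmt h0
  have heD : e ∉ D := fun heD =>
    charge_ne_zero_of_mem (mem_endpoints.2 ⟨e, heD, he ▸ Sym2.mem_mk_left x y⟩ : x ∈ G.endpoints D)
      hx h0
  exact hy (TreeCutDecomp.mem_treeSet_of_ends (G := G.deleteEdges D) (e := ⟨e, heD⟩) he hx)

theorem IsReduced.numEdges_le {ι : Type} {F : ι → Multigraph} {b c d : ℕ} {D : Finset G.E}
    (h : IsReduced F b c d G (G.endpoints D)) {a : ℕ} (ha : tcw (G.deleteEdges D) ≤ a)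
    (hab : a ≤ b) (hb : 0 < b) (hd : 0 < d) :
    G.numEdges ≤ (8 * tameSlack a (2 * a * (2 * b * c)) (a * a * d)
      (a + thinBound a b c d + 2) + 1) * D.card := by
  obtain ⟨𝒟, h𝒟⟩ := (G.deleteEdges D).exists_width_eq_tcw
  have h1 := (h.isSparse hab hb hd).numEdges_le (h𝒟.trans_le ha) (h.charge_treeSet_ne_zero 𝒟)
  have h2 := (charge_le (M := G.endpoints D) h.connected Set.univ).trans
    (Nat.mul_le_mul_left 2 card_endpoints_le)
  rw [← numEdges_deleteEdges_add (D := D), add_mul, one_mul]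
  refine Nat.add_le_add_right ((h1.trans (Nat.mul_le_mul_left _ h2)).trans_eq ?_) _
  ring

end Multigraph

/-- a connected graph with no excessive protrusions, no bouquets
and no thetas is either F-free or has at most `c · OPT_F(G)` edges. -/
theorem no_bouquets_linear {ι : Type} [Fintype ι] (F : ι → Multigraph)
    (hconn : ∀ i, (F i).Connected) (hedge : ∀ i, Nonempty (F i).E)
    (hps : ∃ i, (F i).Planar ∧ (F i).Subcubic)
    (aF : ℕ) (haF : ∀ G : Multigraph, FFree F G → tcw G ≤ aF) (cF : ℕ) :
    ∃ c : ℕ, ∀ G : Multigraph,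
      G.Connected →
      ¬ HasExcessive F (4 * aF ^ 2 + 1) cF G →
      (¬ ∃ (U : Set G.V) (𝒮 : Set (Set G.V)),
        IsBouquet F (dConst F (4 * aF ^ 2 + 1) cF) G U 𝒮) →
      (¬ ∃ u v : G.V, IsTheta (dConst F (4 * aF ^ 2 + 1) cF) G u v) →
      FFree F G ∨ G.numEdges ≤ c * OPT F G := by
  refine ⟨8 * tameSlack aF (2 * aF * (2 * (4 * aF ^ 2 + 1) * cF))
    (aF * aF * dConst F (4 * aF ^ 2 + 1) cF)
    (aF + IsReduced.thinBound aF (4 * aF ^ 2 + 1) cF (dConst F (4 * aF ^ 2 + 1) cF) + 2) + 1,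
    fun G hG hex hbq hth => ?_⟩
  obtain ⟨D, hD, hfree⟩ := exists_deleteEdges_fFree hedge G
  rcases D.eq_empty_or_nonempty with rfl | ⟨e, he⟩
  · exact .inl fun i ⟨I⟩ => hfree i (containsImm_deleteEdges I (by simp))
  · right
    obtain ⟨u, v, huv⟩ := G.exists_ends e
    have h : IsReduced F (4 * aF ^ 2 + 1) cF (dConst F (4 * aF ^ 2 + 1) cF) G (G.endpoints D) :=
      ⟨hG, ⟨u, mem_endpoints.2 ⟨e, he, by simp [huv]⟩⟩, fun X hX => freeOn_of_endpoints hfree hX,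
        hex, hbq, hth⟩
    rw [← hD]
    exact h.numEdges_le (haF _ hfree) (by nlinarith) (Nat.succ_pos _) (Nat.succ_pos _)
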